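/- arXiv:1412.0386 — 2 statements merged into one kernel-verified Lean document; each statement's English description precedes it below -/
import Mathlib

section
/- Let m, n ≥ 1 and let k_1, …, k_n be positive integers, and set μ = min{m − n + 1, k_1 + ⋯ + k_n}. If μ ≥ 1, then the geometric realization of the multiple chessboard complex Δ_{m,n}^{k_1,…,k_n;1} is (μ − 2)-connected. In particular, if m ≥ k_1 + ⋯ + k_n + n − 1, then Δ_{m,n}^{k_1,…,k_n;1} is (k_1 + ⋯ + k_n − 2)-connected. -/
open scoped BigOperators

/-- A face of the multiple chessboard complex `Δ_{m,n}^{k_1,…,k_n; l_1,…,l_m}`: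
a set of squares of the `[m] × [n]` chessboard with at most `k i` squares in row `i`
and at most `l j` squares in column `j`. -/
def IsFace (m n : ℕ) (k : Fin n → ℕ) (l : Fin m → ℕ)
    (A : Finset (Fin m × Fin n)) : Prop :=
  (∀ i : Fin n, (A.filter fun v => v.2 = i).card ≤ k i) ∧
  (∀ j : Fin m, (A.filter fun v => v.1 = j).card ≤ l j)

/-- The geometric realization of the multiple chessboard complex, as the set of
probability distributions on the vertex set whose support is a face. -/
def Realization (m n : ℕ) (k : Fin n → ℕ) (l : Fin m → ℕ) :
    Set ((Fin m × Fin n) → ℝ) :=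
  {f | (∀ v, 0 ≤ f v ∧ f v ≤ 1) ∧ ∑ v, f v = 1 ∧
      IsFace m n k l (Finset.univ.filter fun v => 0 < f v)}

/-- `c`-connectedness of a topological space, for `c : ℤ` (so `(-1)`-connected means
nonempty): nonempty, path-connected when `c ≥ 0`, and trivial homotopy groups `π_i`
for `1 ≤ i ≤ c` at every basepoint. -/
def CConnected (c : ℤ) (X : Type) [TopologicalSpace X] : Prop :=
  Nonempty X ∧ (0 ≤ c → PathConnectedSpace X) ∧
  ∀ i : ℕ, 1 ≤ i → (i : ℤ) ≤ c → ∀ x : X, Subsingleton (HomotopyGroup (Fin i) X x)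

open Metric Set

/-- `SphereExt ι Y`: every continuous map from the boundary of the cube `[-1, 1]^ι` to `Y`
extends to a continuous map from the whole cube to `Y`. -/
def SphereExt (ι : Type*) [Fintype ι] {α : Type*} [TopologicalSpace α] (Y : Set α) : Prop :=
  ∀ f : (ι → ℝ) → α, ContinuousOn f (sphere 0 1) → MapsTo f (sphere 0 1) Y →
    ∃ g : (ι → ℝ) → α, ContinuousOn g (closedBall 0 1) ∧ MapsTo g (closedBall 0 1) Y ∧
      EqOn g f (sphere 0 1)

section SphereExt

variable {ι κ : Type*} [Fintype ι] [Fintype κ] {α β : Type*} [TopologicalSpace α]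
  [TopologicalSpace β]

lemma SphereExt.reindex {Y : Set α} (e : ι ≃ κ) (h : SphereExt ι Y) : SphereExt κ Y := by
  intro f hf hfY
  have hn : ∀ x : ι → ℝ, ‖fun i => x (e.symm i)‖ = ‖x‖ := fun x => by
    refine le_antisymm ((pi_norm_le_iff_of_nonneg (norm_nonneg _)).2 fun i =>
      norm_le_pi_norm x _) ((pi_norm_le_iff_of_nonneg (norm_nonneg _)).2 fun i => ?_)
    simpa using norm_le_pi_norm (fun i => x (e.symm i)) (e i)
  have hn' : ∀ x : κ → ℝ, ‖fun i => x (e i)‖ = ‖x‖ := fun x => by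
    rw [← hn]; simp
  obtain ⟨g, hg, hgY, hgf⟩ := h (fun x => f fun i => x (e.symm i))
    (hf.comp (by fun_prop) fun x hx => by simpa [hn] using hx)
    (fun x hx => hfY (by simpa [hn] using hx))
  refine ⟨fun x => g fun i => x (e i), hg.comp (by fun_prop) fun x hx => ?_, fun x hx => hgY ?_,
    fun x hx => ?_⟩
  · simpa [hn'] using hx
  · simpa [hn'] using hx
  · simpa using hgf (show (fun i => x (e i)) ∈ sphere 0 1 by simpa [hn'] using hx)

lemma sphereExt_singleton (y : α) : SphereExt ι ({y} : Set α) := fun _ _ hfY =>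
  ⟨fun _ => y, continuousOn_const, fun _ _ => rfl, fun _ hx => (hfY hx).symm⟩

lemma SphereExt.of_segment {E : Type*} [NormedAddCommGroup E] [NormedSpace ℝ E] {U : Set E}
    {D : Set β} (r : E → β) (s : β → E) (hr : ContinuousOn r U) (hrD : MapsTo r U D)
    (hs : ContinuousOn s D) (hsU : MapsTo s D U)
    (hseg : ∀ x ∈ U, segment ℝ (s (r x)) x ⊆ U) (h : SphereExt ι D) : SphereExt ι U := by
  classical
  intro f hf hfU
  obtain ⟨G, hG, hGD, hGf⟩ := h (r ∘ f) (hr.comp hf hfU) (hrD.comp hfU)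
  have key : ∀ x : ι → ℝ, x ≠ 0 → ‖x‖⁻¹ • x ∈ sphere (0 : ι → ℝ) 1 := fun x hx => by
    simp [norm_smul, hx]
  let inner : (ι → ℝ) → E := fun x => s (G ((2 : ℝ) • x))
  let outer : (ι → ℝ) → E := fun x =>
    AffineMap.lineMap (s (r (f (‖x‖⁻¹ • x)))) (f (‖x‖⁻¹ • x)) (2 * ‖x‖ - 1)
  have hagree : ∀ x : ι → ℝ, ‖x‖ = 1 / 2 → inner x = outer x := by
    intro x hx
    have h2 : ‖x‖⁻¹ • x = (2 : ℝ) • x := by rw [hx]; norm_num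
    have h3 : (2 : ℝ) • x ∈ sphere (0 : ι → ℝ) 1 := by simp [norm_smul, hx]
    simp only [inner, outer, h2]
    rw [hx, hGf h3]
    norm_num
  have hc1 : ContinuousOn inner (closedBall 0 (1 / 2)) := by
    refine hs.comp (hG.comp (by fun_prop) ?_) ?_
    · intro x hx
      simp [norm_smul] at hx ⊢; linarith
    · intro x hx
      apply hGD
      simp [norm_smul] at hx ⊢; linarith
  have hc2 : ContinuousOn outer {x | 1 / 2 ≤ ‖x‖} := by
    have h0 : ∀ x ∈ {x : ι → ℝ | 1 / 2 ≤ ‖x‖}, x ≠ 0 := by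
      rintro x hx rfl
      norm_num at hx
    have h1 : ContinuousOn (fun x : ι → ℝ => f (‖x‖⁻¹ • x)) {x | 1 / 2 ≤ ‖x‖} := by
      refine hf.comp ?_ fun x hx => key x (h0 x hx)
      exact (continuousOn_id.norm.inv₀ fun x hx => norm_ne_zero_iff.2 (h0 x hx)).smul
        continuousOn_id
    have h2 : ContinuousOn (fun x : ι → ℝ => s (r (f (‖x‖⁻¹ • x)))) {x | 1 / 2 ≤ ‖x‖} :=
      hs.comp (hr.comp h1 fun x hx => hfU (key x (h0 x hx)))
        fun x hx => hrD (hfU (key x (h0 x hx)))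
    have h3 : ContinuousOn (fun x : ι → ℝ => 2 * ‖x‖ - 1) {x | 1 / 2 ≤ ‖x‖} := by fun_prop
    simp only [outer, AffineMap.lineMap_apply_module]
    exact ((continuousOn_const.sub h3).smul h2).add (h3.smul h1)
  let F : (ι → ℝ) → E := fun x => if ‖x‖ ≤ 1 / 2 then inner x else outer x
  have hF1 : EqOn F inner (closedBall 0 (1 / 2)) := fun x hx => by
    have : ‖x‖ ≤ 1 / 2 := by simpa using hx
    simp only [F, if_pos this]
  have hF2 : EqOn F outer {x | 1 / 2 ≤ ‖x‖} := fun x hx => by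
    by_cases h : ‖x‖ ≤ 1 / 2
    · simp only [F, if_pos h]
      exact hagree x (le_antisymm h hx)
    · simp only [F, if_neg h]
  refine ⟨F, ?_, ?_, ?_⟩
  · refine ContinuousOn.mono (s := closedBall 0 (1 / 2) ∪ {x | 1 / 2 ≤ ‖x‖}) ?_ fun x _ => ?_
    · exact (hc1.congr hF1).union_of_isClosed (hc2.congr hF2) isClosed_closedBall
        (isClosed_le continuous_const continuous_norm)
    · rcases le_total ‖x‖ (1 / 2) with h | h
      · left; simpa using h
      · right; exact h
  · intro x hx
    have hx : ‖x‖ ≤ 1 := by simpa using hx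
    rcases le_total ‖x‖ (1 / 2) with h | h
    · rw [hF1 (by simpa using h)]
      apply hsU; apply hGD
      simp [norm_smul]; linarith
    · rw [hF2 h]
      have h0 : x ≠ 0 := by
        rintro rfl
        norm_num at h
      apply hseg _ (hfU (key x h0))
      rw [segment_eq_image_lineMap]
      exact ⟨_, ⟨by linarith, by linarith⟩, rfl⟩
  · intro x hx
    have hx : ‖x‖ = 1 := by simpa using hx
    rw [hF2 (by simp [hx]; norm_num)]
    simp only [outer, hx]
    norm_num

end SphereExt

section Grid

/-- Codes of cells of the cubical grid on `ℝ`: an even integer `b` is the point `b`, an odd integer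
`b` is the interval `[b - 1, b + 1]`. This is the code of the smallest cell containing `x`. -/
noncomputable def cellCode (x : ℝ) : ℤ :=
  if x = (2 * ⌊x / 2⌋ : ℤ) then 2 * ⌊x / 2⌋ else 2 * ⌊x / 2⌋ + 1

lemma cellCode_even {x : ℝ} (h : ¬ Odd (cellCode x)) : x = cellCode x := by
  unfold cellCode at h ⊢
  split_ifs at h ⊢ with h1
  · exact h1
  · exact absurd ⟨_, rfl⟩ h

lemma cellCode_odd {x : ℝ} (h : Odd (cellCode x)) : |x - cellCode x| < 1 := by
  unfold cellCode at h ⊢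
  split_ifs at h ⊢ with h1
  · exact absurd h (by simp)
  · have h2 := Int.floor_le (x / 2)
    have h3 := Int.lt_floor_add_one (x / 2)
    push_cast at h1 ⊢
    rw [abs_lt]
    constructor
    · have : 2 * (⌊x / 2⌋ : ℝ) ≤ x := by linarith
      have := lt_of_le_of_ne this (Ne.symm h1)
      linarith
    · linarith

lemma cellCode_int {b : ℤ} (hb : ¬ Odd b) : cellCode b = b := by
  obtain ⟨c, rfl⟩ := Int.not_odd_iff_even.1 hb
  have : ⌊((c + c : ℤ) : ℝ) / 2⌋ = c := by
    have : ((c + c : ℤ) : ℝ) / 2 = c := by push_cast; ring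
    rw [this, Int.floor_intCast]
  unfold cellCode
  rw [this, if_pos]
  · ring
  · push_cast; ring

lemma cellCode_eq_or {x : ℝ} {b : ℤ} (h : |x - b| ≤ if Odd b then 1 else 0) :
    cellCode x = b ∨ (Odd b ∧ ¬ Odd (cellCode x) ∧ |x - b| = 1) := by
  by_cases hb : Odd b
  · rw [if_pos hb] at h
    by_cases hx : Odd (cellCode x)
    · left
      have h1 := cellCode_odd hx
      have h2 : |((cellCode x - b : ℤ) : ℝ)| < 2 := by
        push_cast
        rw [abs_lt] at h1 ⊢
        rw [abs_le] at h
        constructor <;> linarith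
      have h3 : |cellCode x - b| < 2 := by exact_mod_cast h2
      rw [abs_lt] at h3
      obtain ⟨p, hp⟩ := hb
      obtain ⟨q, hq⟩ := hx
      omega
    · right
      refine ⟨hb, hx, ?_⟩
      have h1 := cellCode_even hx
      have h2 : cellCode x ≠ b := fun h => hx (h ▸ hb)
      rw [h1] at h ⊢
      have h3 : |cellCode x - b| ≤ 1 := by exact_mod_cast h
      have h4 : 0 < |cellCode x - b| := abs_pos.2 (sub_ne_zero.2 h2)
      have : |cellCode x - b| = 1 := by omega
      exact_mod_cast this
  · left
    rw [if_neg hb] at h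
    have : x = b := by
      have := abs_nonpos_iff.1 h
      linarith
    rw [this, cellCode_int hb]

lemma cellCode_lt {x : ℝ} {N : ℕ} (h : |x| < 2 * N) : |cellCode x| < 2 * N := by
  by_cases hx : Odd (cellCode x)
  · have h1 := cellCode_odd hx
    have h2 : |(cellCode x : ℝ)| < 2 * N + 1 := by
      rw [abs_lt] at *
      constructor <;> linarith
    have h3 : |cellCode x| < 2 * N + 1 := by exact_mod_cast h2
    obtain ⟨p, hp⟩ := hx
    rw [abs_lt] at *
    omega
  · rw [cellCode_even hx] at h
    exact_mod_cast h

lemma abs_le_of_mem_cell {x : ℝ} {b : ℤ} {N : ℕ} (h : |x - b| ≤ if Odd b then 1 else 0)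
    (hb : |b| < 2 * N) : |x| ≤ 2 * N := by
  have h1 : |x - b| ≤ 1 := h.trans (by split_ifs <;> norm_num)
  have h2 : |b| + 1 ≤ 2 * N := by omega
  have h3 : |(b : ℝ)| + 1 ≤ 2 * N := by exact_mod_cast h2
  have := abs_sub_abs_le_abs_sub x b
  linarith

variable {ι : Type*}

/-- The closed grid cell with code `b`. -/
def gridCell (b : ι → ℤ) : Set (ι → ℝ) :=
  {x | ∀ t, |x t - b t| ≤ if Odd (b t) then 1 else 0}

/-- The relative boundary of the grid cell with code `b`. -/
def gridBoundary (b : ι → ℤ) : Set (ι → ℝ) :=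
  {x ∈ gridCell b | ∃ t, Odd (b t) ∧ |x t - b t| = 1}

/-- The cell with code `a` is a face of the cell with code `b`. -/
def GridFace (a b : ι → ℤ) : Prop :=
  ∀ t, a t = b t ∨ (Odd (b t) ∧ ¬ Odd (a t) ∧ |a t - b t| = 1)

/-- The code of the smallest grid cell containing `x`. -/
noncomputable def gridCode (x : ι → ℝ) : ι → ℤ := fun t => cellCode (x t)

/-- The dimension of a grid cell. -/
def gridDim [Fintype ι] (b : ι → ℤ) : ℕ := Fintype.card {t // Odd (b t)}

lemma GridFace.trans {a b c : ι → ℤ} (h : GridFace a b) (h' : GridFace b c) : GridFace a c := by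
  intro t
  rcases h t with h1 | ⟨h1, h2, h3⟩
  · rw [h1]; exact h' t
  · rcases h' t with h4 | ⟨_, h4, _⟩
    · rw [← h4]; exact Or.inr ⟨h1, h2, h3⟩
    · exact absurd h1 h4

lemma mem_gridCell_gridCode (x : ι → ℝ) : x ∈ gridCell (gridCode x) := by
  intro t
  unfold gridCode
  split_ifs with h
  · exact (cellCode_odd h).le
  · rw [← cellCode_even h]; simp

lemma gridFace_gridCode {x : ι → ℝ} {b : ι → ℤ} (h : x ∈ gridCell b) :
    GridFace (gridCode x) b := by
  intro t
  rcases cellCode_eq_or (h t) with h1 | ⟨h1, h2, h3⟩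
  · exact Or.inl h1
  · refine Or.inr ⟨h1, h2, ?_⟩
    rw [cellCode_even h2] at h3
    exact_mod_cast h3

lemma gridCode_eq_or {x : ι → ℝ} {b : ι → ℤ} (h : x ∈ gridCell b) :
    gridCode x = b ∨ x ∈ gridBoundary b := by
  by_cases hb : gridCode x = b
  · exact Or.inl hb
  · obtain ⟨t, ht⟩ := Function.ne_iff.1 hb
    obtain h1 | ⟨h1, h2, h3⟩ := cellCode_eq_or (h t)
    · exact absurd h1 ht
    · exact Or.inr ⟨h, t, h1, h3⟩

lemma gridCode_ne {x : ι → ℝ} {b : ι → ℤ} (h : x ∈ gridBoundary b) : gridCode x ≠ b := by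
  rintro rfl
  obtain ⟨_, t, h1, h2⟩ := h
  exact (cellCode_odd h1).ne h2

lemma isClosed_gridCell (b : ι → ℤ) : IsClosed (gridCell b) := by
  simp only [gridCell, Set.ofPred_forall]
  exact isClosed_iInter fun t => isClosed_le (by fun_prop) continuous_const

variable [Fintype ι]

lemma GridFace.eq_of_dim_le {a b : ι → ℤ} (h : GridFace a b) (hd : gridDim b ≤ gridDim a) :
    a = b := by
  classical
  simp only [gridDim, Fintype.card_subtype] at hd
  have hsub : (Finset.univ.filter fun t => Odd (a t)) ⊆ Finset.univ.filter fun t => Odd (b t) := by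
    intro t ht
    simp only [Finset.mem_filter, Finset.mem_univ, true_and] at ht ⊢
    rcases h t with h1 | ⟨h1, _, _⟩
    · rwa [← h1]
    · exact h1
  have heq := Finset.eq_of_subset_of_card_le hsub hd
  funext t
  rcases h t with h1 | ⟨h1, h2, _⟩
  · exact h1
  · have : t ∈ Finset.univ.filter fun t => Odd (a t) := by rw [heq]; simpa using h1
    exact absurd (by simpa using this) h2

variable {α : Type*} [TopologicalSpace α]

lemma exists_extension_gridCell {b : ι → ℤ} {Y : Set α} (h : SphereExt (Fin (gridDim b)) Y)
    {f : (ι → ℝ) → α} (hf : ContinuousOn f (gridBoundary b)) (hfY : MapsTo f (gridBoundary b) Y) :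
    ∃ g, ContinuousOn g (gridCell b) ∧ MapsTo g (gridCell b) Y ∧ EqOn g f (gridBoundary b) := by
  classical
  replace h : SphereExt {t // Odd (b t)} Y := h.reindex (Fintype.equivFin _).symm
  let φ : ({t // Odd (b t)} → ℝ) → ι → ℝ := fun u t => b t + if h : Odd (b t) then u ⟨t, h⟩ else 0
  let ψ : (ι → ℝ) → {t // Odd (b t)} → ℝ := fun x t => x t - b t
  have hφc : Continuous φ := by
    refine continuous_pi fun t => ?_
    by_cases h : Odd (b t)
    · simp only [φ, dif_pos h]; fun_prop
    · simp only [φ, dif_neg h]; fun_prop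
  have hψc : Continuous ψ := by fun_prop
  have hφ : ∀ u ∈ sphere (0 : {t // Odd (b t)} → ℝ) 1, φ u ∈ gridBoundary b := by
    intro u hu
    have hu : ‖u‖ = 1 := by simpa using hu
    refine ⟨fun t => ?_, ?_⟩
    · by_cases h : Odd (b t)
      · simp only [φ, dif_pos h, if_pos h, add_sub_cancel_left]
        exact hu ▸ norm_le_pi_norm u ⟨t, h⟩
      · simp [φ, h]
    · by_contra! hcon
      have : ‖u‖ < 1 := by
        rw [pi_norm_lt_iff one_pos]
        rintro ⟨t, ht⟩
        refine lt_of_le_of_ne (hu ▸ norm_le_pi_norm u ⟨t, ht⟩) ?_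
        simpa [φ, ht] using hcon t ht
      exact this.ne hu
  have hψ : ∀ x ∈ gridCell b, ψ x ∈ closedBall (0 : {t // Odd (b t)} → ℝ) 1 := by
    intro x hx
    rw [mem_closedBall_zero_iff, pi_norm_le_iff_of_nonneg zero_le_one]
    rintro ⟨t, ht⟩
    simpa [ψ, ht] using hx t
  have hψ' : ∀ x ∈ gridBoundary b, ψ x ∈ sphere (0 : {t // Odd (b t)} → ℝ) 1 := by
    intro x hx
    obtain ⟨hx, t, ht, hxt⟩ := hx
    have h1 := hψ x hx
    rw [mem_closedBall_zero_iff] at h1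
    rw [mem_sphere_zero_iff_norm]
    refine le_antisymm h1 ?_
    have := norm_le_pi_norm (ψ x) ⟨t, ht⟩
    rw [Real.norm_eq_abs] at this
    exact hxt ▸ this
  have hφψ : ∀ x ∈ gridCell b, φ (ψ x) = x := by
    intro x hx
    funext t
    by_cases h : Odd (b t)
    · simp [φ, ψ, h]
    · have := hx t
      simp only [h, if_false, abs_nonpos_iff] at this
      simp only [φ, h, dif_neg, not_false_eq_true]
      linarith
  obtain ⟨g, hg, hgY, hgf⟩ := h (f ∘ φ) (hf.comp hφc.continuousOn hφ) (hfY.comp hφ)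
  refine ⟨g ∘ ψ, hg.comp hψc.continuousOn hψ, hgY.comp hψ, fun x hx => ?_⟩
  have := hgf (hψ' x hx)
  simpa [hφψ x hx.1] using this

lemma exists_extension_of_carrier {N : ℕ} {Y : (ι → ℤ) → Set α}
    (hmono : ∀ a b, GridFace a b → Y a ⊆ Y b)
    (hE : ∀ b : ι → ℤ, (∀ t, |b t| < 2 * N) → SphereExt (Fin (gridDim b)) (Y b))
    {f : (ι → ℝ) → α} (hf : ContinuousOn f (sphere 0 (2 * N)))
    (hfY : ∀ x ∈ sphere (0 : ι → ℝ) (2 * N), f x ∈ Y (gridCode x)) (hN : 0 < N) :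
    ∃ g, ContinuousOn g (closedBall 0 (2 * N)) ∧ EqOn g f (sphere 0 (2 * N)) ∧
      ∀ x ∈ closedBall (0 : ι → ℝ) (2 * N), g x ∈ Y (gridCode x) := by
  classical
  set S : Set (ι → ℝ) := sphere 0 (2 * N) with hS
  have hint : ∀ x : ι → ℝ, ‖x‖ ≤ 2 * N → x ∈ S ∨ ∀ t, |gridCode x t| < 2 * N := by
    intro x hx
    rcases hx.lt_or_eq with h | h
    · right
      intro t
      exact cellCode_lt ((norm_le_pi_norm x t).trans_lt h)
    · left; simpa [hS] using h
  have hSint : ∀ x ∈ S, ¬ ∀ t, |gridCode x t| < 2 * N := by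
    intro x hx hcon
    have hx : ‖x‖ = 2 * N := by simpa [hS] using hx
    have hpos : (0 : ℝ) < 2 * N := by positivity
    have : ‖x‖ < 2 * N := by
      rw [pi_norm_lt_iff hpos]
      intro t
      have h1 : |x t| ≤ 2 * N := hx ▸ norm_le_pi_norm x t
      refine lt_of_le_of_ne h1 fun h2 => ?_
      have h2 : |x t| = 2 * N := h2
      have h3 := hcon t
      rcases (abs_eq hpos.le).1 h2 with h4 | h4
      · have : gridCode x t = 2 * N := by
          have := cellCode_int (b := 2 * N) (by simp)
          unfold gridCode
          rw [h4]
          simpa using this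
        rw [this] at h3
        simp at h3
      · have : gridCode x t = -(2 * N) := by
          have := cellCode_int (b := -(2 * N)) (by simp)
          unfold gridCode
          rw [h4]
          simpa using this
        rw [this] at h3
        simp at h3
    exact this.ne hx
  have main : ∀ s : Finset (ι → ℤ), (∀ b ∈ s, ∀ t, |b t| < 2 * N) →
      (∀ b ∈ s, ∀ a, GridFace a b → (∀ t, |a t| < 2 * N) → a ∈ s) →
      ∃ g, ContinuousOn g (S ∪ ⋃ b ∈ s, gridCell b) ∧ EqOn g f S ∧
        ∀ x ∈ S ∪ ⋃ b ∈ s, gridCell b, g x ∈ Y (gridCode x) := by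
    intro s
    refine Finset.induction_on_max_value gridDim s
      (fun _ _ => ⟨f, by simpa using hf, fun _ _ => rfl, by simpa using hfY⟩) ?_
    intro b s hbs hmax ih hs hface
    obtain ⟨g, hg, hgf, hgY⟩ := ih (fun a ha => hs a (Finset.mem_insert_of_mem ha)) (by
      intro c hc a hac ha
      rcases Finset.mem_insert.1 (hface c (Finset.mem_insert_of_mem hc) a hac ha) with h | h
      · subst h
        exact hac.eq_of_dim_le (hmax c hc) ▸ hc
      · exact h)
    set A : Set (ι → ℝ) := S ∪ ⋃ b ∈ s, gridCell b with hA
    have hAc : IsClosed A := isClosed_sphere.union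
      (s.finite_toSet.isClosed_biUnion fun c _ => isClosed_gridCell c)
    have hbint := hs b (Finset.mem_insert_self _ _)
    have h1 : gridBoundary b ⊆ A := by
      intro x hx
      have hxn : ‖x‖ ≤ 2 * N := by
        rw [pi_norm_le_iff_of_nonneg (by positivity)]
        exact fun t => abs_le_of_mem_cell (hx.1 t) (hbint t)
      rcases hint x hxn with h | h
      · exact Or.inl h
      · right
        have := hface b (Finset.mem_insert_self _ _) _ (gridFace_gridCode hx.1) h
        rcases Finset.mem_insert.1 this with h2 | h2
        · exact absurd h2 (gridCode_ne hx)
        · exact mem_iUnion₂.2 ⟨_, h2, mem_gridCell_gridCode x⟩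
    have h2 : gridCell b ∩ A ⊆ gridBoundary b := by
      rintro x ⟨hxb, hxA⟩
      rcases gridCode_eq_or hxb with h | h
      · exfalso
        rcases hxA with hxA | hxA
        · exact hSint x hxA (h ▸ hbint)
        · obtain ⟨c, hc, hxc⟩ := mem_iUnion₂.1 hxA
          have h3 := gridFace_gridCode hxc
          rw [h] at h3
          exact hbs (h3.eq_of_dim_le (hmax c hc) ▸ hc)
      · exact h
    obtain ⟨e, he, heY, heg⟩ := exists_extension_gridCell (hE b hbint) (hg.mono h1)
      (fun x hx => hmono _ _ (gridFace_gridCode hx.1) (hgY x (h1 hx)))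
    let G : (ι → ℝ) → α := fun x => if x ∈ A then g x else e x
    have hGA : EqOn G g A := fun x hx => by simp only [G, if_pos hx]
    have hGb : EqOn G e (gridCell b) := fun x hx => by
      by_cases hxA : x ∈ A
      · rw [hGA hxA, heg (h2 ⟨hx, hxA⟩)]
      · simp only [G, if_neg hxA]
    have hunion : S ∪ ⋃ c ∈ insert b s, gridCell c = A ∪ gridCell b := by
      rw [Finset.set_biUnion_insert, hA, Set.union_assoc, Set.union_comm (gridCell b)]
    rw [hunion]
    refine ⟨G, (hg.congr hGA).union_of_isClosed (he.congr hGb) hAc (isClosed_gridCell b),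
      fun x hx => (hGA (Or.inl hx)).trans (hgf hx), ?_⟩
    intro x hx
    by_cases hxA : x ∈ A
    · rw [hGA hxA]; exact hgY x hxA
    · have hxb := hx.resolve_left hxA
      rw [hGb hxb]
      rcases gridCode_eq_or hxb with h | h
      · rw [h]; exact heY hxb
      · exact absurd (h1 h) hxA
  obtain ⟨g, hg, hgf, hgY⟩ := main (Fintype.piFinset fun _ => Finset.Ioo (-(2 * N : ℤ)) (2 * N))
    (by
      intro b hb t
      rw [Fintype.mem_piFinset] at hb
      exact abs_lt.2 (Finset.mem_Ioo.1 (hb t)))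
    (by
      intro b hb a _ ha
      rw [Fintype.mem_piFinset]
      exact fun t => Finset.mem_Ioo.2 (abs_lt.1 (ha t)))
  have hsub : closedBall (0 : ι → ℝ) (2 * N) ⊆
      S ∪ ⋃ b ∈ Fintype.piFinset fun _ => Finset.Ioo (-(2 * N : ℤ)) (2 * N), gridCell b := by
    intro x hx
    rcases hint x (by simpa using hx) with h | h
    · exact Or.inl h
    · refine Or.inr (mem_iUnion₂.2 ⟨_, ?_, mem_gridCell_gridCode x⟩)
      rw [Fintype.mem_piFinset]
      exact fun t => Finset.mem_Ioo.2 (abs_lt.1 (h t))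
  exact ⟨g, hg.mono hsub, hgf, fun x hx => hgY x (hsub hx)⟩

/-- Gluing: connectivity of a space covered by two open sets. -/
lemma SphereExt.of_openCover {d : ℕ} {X : Set α} {O : Bool → Set α} (hO : ∀ i, IsOpen (O i))
    (hX : X ⊆ ⋃ i, O i) (h1 : ∀ i, ∀ j ≤ d, SphereExt (Fin j) (X ∩ O i))
    (h2 : ∀ j < d, SphereExt (Fin j) (X ∩ (O true ∩ O false))) : SphereExt (Fin d) X := by
  classical
  intro f hf hfX
  have hu : ∀ i, ∃ u : Set (Fin d → ℝ), IsOpen u ∧ f ⁻¹' O i ∩ sphere 0 1 = u ∩ sphere 0 1 :=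
    fun i => (continuousOn_iff'.1 hf) (O i) (hO i)
  choose u huo hu using hu
  obtain ⟨δ, hδ, hδu⟩ := lebesgue_number_lemma_of_metric (isCompact_sphere (0 : Fin d → ℝ) 1) huo
    (fun x hx => by
      obtain ⟨i, hi⟩ := mem_iUnion.1 (hX (hfX hx))
      exact mem_iUnion.2 ⟨i, ((hu i).subset ⟨hi, hx⟩).1⟩)
  obtain ⟨N, hN⟩ := exists_nat_gt (1 / δ)
  have hNpos : (0 : ℝ) < N := (by positivity : 0 < 1 / δ).trans hN
  have hNδ : (N : ℝ)⁻¹ < δ := by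
    rw [one_div] at hN
    exact (inv_lt_comm₀ hδ hNpos).1 hN
  set r : ℝ := (2 * N : ℝ)⁻¹ with hr
  have hrpos : 0 < r := by positivity
  have hrN : r * (2 * N) = 1 := inv_mul_cancel₀ (by positivity)
  have hsph : ∀ x ∈ sphere (0 : Fin d → ℝ) (2 * N), r • x ∈ sphere (0 : Fin d → ℝ) 1 := by
    intro x hx
    rw [mem_sphere_zero_iff_norm] at hx ⊢
    rw [norm_smul, hx, Real.norm_of_nonneg hrpos.le, hrN]
  have hcol : ∀ c : Fin d → ℤ, ∃ i, ∀ x ∈ sphere (0 : Fin d → ℝ) (2 * N), x ∈ gridCell c →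
      f (r • x) ∈ O i := by
    intro c
    by_cases hne : ∃ y ∈ sphere (0 : Fin d → ℝ) (2 * N), y ∈ gridCell c
    · obtain ⟨y, hy, hyc⟩ := hne
      obtain ⟨i, hi⟩ := hδu _ (hsph y hy)
      refine ⟨i, fun x hx hxc => ((hu i).symm.subset ⟨hi ?_, hsph x hx⟩).1⟩
      rw [mem_ball, dist_eq_norm, ← smul_sub, norm_smul, Real.norm_of_nonneg hrpos.le]
      have : ‖x - y‖ ≤ 2 := by
        rw [pi_norm_le_iff_of_nonneg zero_le_two]
        intro t
        have ha : |x t - c t| ≤ 1 := (hxc t).trans (by split_ifs <;> norm_num)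
        have hb : |y t - c t| ≤ 1 := (hyc t).trans (by split_ifs <;> norm_num)
        rw [Pi.sub_apply, Real.norm_eq_abs]
        rw [abs_le] at *
        constructor <;> linarith
      calc r * ‖x - y‖ ≤ r * 2 := by gcongr
        _ = (N : ℝ)⁻¹ := by rw [hr]; field_simp
        _ < δ := hNδ
    · exact ⟨true, fun x hx hxc => absurd ⟨x, hx, hxc⟩ hne⟩
  choose col hcol using hcol
  let Y : (Fin d → ℤ) → Set α := fun b =>
    {z ∈ X | ∀ c : Fin d → ℤ, (∀ t, Odd (c t)) → GridFace b c → z ∈ O (col c)}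
  have hE : ∀ b : Fin d → ℤ, SphereExt (Fin (gridDim b)) (Y b) := by
    intro b
    have hle : gridDim b ≤ d := by
      simpa [gridDim] using Fintype.card_subtype_le fun t => Odd (b t)
    obtain ⟨c₀, hc₀, hbc₀⟩ : ∃ c : Fin d → ℤ, (∀ t, Odd (c t)) ∧ GridFace b c := by
      refine ⟨fun t => if Odd (b t) then b t else b t + 1, fun t => ?_, fun t => ?_⟩
      · dsimp only
        split_ifs with h
        · exact h
        · exact (Int.not_odd_iff_even.1 h).add_one
      · dsimp only
        split_ifs with h
        · exact Or.inl rfl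
        · exact Or.inr ⟨(Int.not_odd_iff_even.1 h).add_one, h, by simp⟩
    by_cases hall : ∀ c : Fin d → ℤ, (∀ t, Odd (c t)) → GridFace b c → col c = col c₀
    · have : Y b = X ∩ O (col c₀) := by
        ext z
        refine ⟨fun hz => ⟨hz.1, hz.2 c₀ hc₀ hbc₀⟩, fun hz => ⟨hz.1, fun c hc hbc => ?_⟩⟩
        rw [hall c hc hbc]; exact hz.2
      rw [this]
      exact h1 _ _ hle
    · push Not at hall
      obtain ⟨c₁, hc₁, hbc₁, hne⟩ := hall
      have hlt : gridDim b < d := by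
        refine lt_of_le_of_ne hle fun heq => hne ?_
        have hdim : ∀ c : Fin d → ℤ, gridDim c ≤ gridDim b := fun c => by
          rw [heq]
          simpa [gridDim] using Fintype.card_subtype_le fun t => Odd (c t)
        rw [← hbc₀.eq_of_dim_le (hdim _), ← hbc₁.eq_of_dim_le (hdim _)]
      have : Y b = X ∩ (O true ∩ O false) := by
        ext z
        constructor
        · intro hz
          have ha := hz.2 c₀ hc₀ hbc₀
          have hb := hz.2 c₁ hc₁ hbc₁
          refine ⟨hz.1, ?_⟩
          cases h0 : col c₀ <;> cases h1 : col c₁ <;> simp_all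
        · rintro ⟨hz, hzt, hzf⟩
          refine ⟨hz, fun c _ _ => ?_⟩
          cases col c
          · exact hzf
          · exact hzt
      rw [this]
      exact h2 _ hlt
  obtain ⟨g, hg, hgf, hgY⟩ := exists_extension_of_carrier (N := N) (Y := Y)
    (f := fun x => f (r • x))
    (fun a b hab z hz => ⟨hz.1, fun c hc hbc => hz.2 c hc (hab.trans hbc)⟩)
    (fun b _ => hE b) (hf.comp (by fun_prop) hsph)
    (fun x hx => ⟨hfX (hsph x hx), fun c _ hc => hcol c x hx fun t => by
      rcases hc t with h | ⟨h, h', h''⟩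
      · rw [← h]; exact mem_gridCell_gridCode x t
      · rw [if_pos h]
        have : x t = gridCode x t := cellCode_even h'
        rw [this]
        exact_mod_cast h''.le⟩)
    (by exact_mod_cast hNpos)
  have hnorm : ∀ x : Fin d → ℝ, ‖((2 * N : ℝ)) • x‖ = 2 * N * ‖x‖ := fun x => by
    rw [norm_smul, Real.norm_of_nonneg (by positivity)]
  have hball : ∀ x ∈ closedBall (0 : Fin d → ℝ) 1,
      ((2 * N : ℝ)) • x ∈ closedBall (0 : Fin d → ℝ) (2 * N) := by
    intro x hx
    rw [mem_closedBall_zero_iff] at hx ⊢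
    rw [hnorm]
    nlinarith
  refine ⟨fun x => g ((2 * N : ℝ) • x), hg.comp (by fun_prop) hball,
    fun x hx => (hgY _ (hball x hx)).1, fun x hx => ?_⟩
  have hx' : ((2 * N : ℝ)) • x ∈ sphere (0 : Fin d → ℝ) (2 * N) := by
    rw [mem_sphere_zero_iff_norm] at hx ⊢
    rw [hnorm, hx, mul_one]
  have := hgf hx'
  dsimp only at this ⊢
  rw [this, smul_smul, hrN, one_smul]

end Grid

section Simplicial

variable {V : Type*}

lemma convex_lt (v : V) (c : ℝ) : Convex ℝ {f : V → ℝ | f v < c} :=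
  convex_halfSpace_lt (f := fun f : V → ℝ => f v) (LinearMap.proj (R := ℝ) v).isLinear c

lemma convex_gt (v : V) (c : ℝ) : Convex ℝ {f : V → ℝ | c < f v} :=
  convex_halfSpace_gt (f := fun f : V → ℝ => f v) (LinearMap.proj (R := ℝ) v).isLinear c

section

variable [DecidableEq V]

/-- The radial projection away from the vertex `v`. -/
noncomputable def radial (v : V) (f : V → ℝ) : V → ℝ :=
  fun w => if w = v then 0 else f w / (1 - f v)

lemma radial_pos {v w : V} {f : V → ℝ} (hv : f v < 1) :
    0 < radial v f w ↔ w ≠ v ∧ 0 < f w := by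
  have : 0 < 1 - f v := by linarith
  unfold radial
  split_ifs with h <;> simp [h, div_pos_iff_of_pos_right this]

lemma continuousOn_radial (v : V) : ContinuousOn (radial v) {f | f v < 1} := by
  refine continuousOn_pi.2 fun w => ?_
  unfold radial
  split_ifs
  · exact continuousOn_const
  · exact ContinuousOn.div (by fun_prop) (by fun_prop) fun f (hf : f v < 1) => by linarith

end

variable [Fintype V]

/-- The geometric realization of a family of finite subsets of `V`. -/
def geomReal (K : Set (Finset V)) : Set (V → ℝ) :=
  {f | (∀ v, 0 ≤ f v) ∧ ∑ v, f v = 1 ∧ (Finset.univ.filter fun v => 0 < f v) ∈ K}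

/-- The closed simplex spanned by `σ`. -/
def geomSimplex (σ : Finset V) : Set (V → ℝ) :=
  {f | (∀ v, 0 ≤ f v) ∧ ∑ v, f v = 1 ∧ ∀ v ∉ σ, f v = 0}

lemma convex_geomSimplex (σ : Finset V) : Convex ℝ (geomSimplex σ) := by
  rintro f ⟨hf0, hf1, hf⟩ g ⟨hg0, hg1, hg⟩ a b ha hb hab
  refine ⟨fun v => ?_, ?_, fun v hv => ?_⟩
  · have := hf0 v
    have := hg0 v
    simp only [Pi.add_apply, Pi.smul_apply, smul_eq_mul]
    positivity
  · simp only [Pi.add_apply, Pi.smul_apply, smul_eq_mul, Finset.sum_add_distrib,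
      ← Finset.mul_sum, hf1, hg1, mul_one, hab]
  · simp [hf v hv, hg v hv]

lemma mem_geomSimplex {K : Set (Finset V)} {f : V → ℝ} (hf : f ∈ geomReal K) :
    f ∈ geomSimplex (Finset.univ.filter fun v => 0 < f v) := by
  refine ⟨hf.1, hf.2.1, fun v hv => ?_⟩
  simp only [Finset.mem_filter, Finset.mem_univ, true_and, not_lt] at hv
  exact le_antisymm hv (hf.1 v)

lemma sphereExt_starShaped {ι : Type*} [Fintype ι] {U : Set (V → ℝ)} {x : V → ℝ} (hx : x ∈ U)
    (h : ∀ y ∈ U, segment ℝ x y ⊆ U) : SphereExt ι U :=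
  SphereExt.of_segment (fun _ => x) id continuousOn_const (fun _ _ => mem_singleton x)
    continuousOn_id (by rintro _ rfl; exact hx) h (sphereExt_singleton x)

variable [DecidableEq V]

lemma geomSimplex_subset {K : Set (Finset V)} (hK : IsLowerSet K) {σ : Finset V} (hσ : σ ∈ K) :
    geomSimplex σ ⊆ geomReal K := by
  rintro f ⟨hf0, hf1, hf⟩
  refine ⟨hf0, hf1, hK (fun v hv => ?_) hσ⟩
  by_contra h
  simp [hf v h] at hv

lemma single_mem_geomSimplex {σ : Finset V} {v : V} (hv : v ∈ σ) :
    (Pi.single v 1 : V → ℝ) ∈ geomSimplex σ := by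
  refine ⟨fun w => ?_, by simp, fun w hw => ?_⟩
  · rcases eq_or_ne w v with rfl | h <;> simp [*]
  · exact Pi.single_eq_of_ne (by rintro rfl; exact hw hv) _

lemma radial_mem_geomSimplex {v : V} {f : V → ℝ} {σ : Finset V} (hf : f ∈ geomSimplex σ)
    (hv : f v < 1) : radial v f ∈ geomSimplex (σ.erase v) := by
  have h1 : 0 < 1 - f v := by linarith
  refine ⟨fun w => ?_, ?_, fun w hw => ?_⟩
  · unfold radial
    split_ifs
    · exact le_rfl
    · exact div_nonneg (hf.1 w) h1.le
  · have h2 := hf.2.1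
    rw [← Finset.add_sum_erase _ _ (Finset.mem_univ v)] at h2 ⊢
    have h3 : ∑ w ∈ Finset.univ.erase v, radial v f w =
        ∑ w ∈ Finset.univ.erase v, f w / (1 - f v) :=
      Finset.sum_congr rfl fun w hw => if_neg (Finset.ne_of_mem_erase hw)
    rw [h3, ← Finset.sum_div, radial, if_pos rfl, zero_add, div_eq_one_iff_eq h1.ne']
    linarith
  · unfold radial
    split_ifs with h
    · rfl
    · rw [hf.2.2 w fun h' => hw (Finset.mem_erase.2 ⟨h, h'⟩), zero_div]

lemma support_radial {v : V} {f : V → ℝ} (hv : f v < 1) :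
    (Finset.univ.filter fun w => 0 < radial v f w) =
      (Finset.univ.filter fun w => 0 < f w).erase v := by
  ext w
  simp [radial_pos hv]

lemma radial_mem_geomReal {K L : Set (Finset V)} {v : V} {f : V → ℝ} (hf : f ∈ geomReal K)
    (hv : f v < 1) (hL : (Finset.univ.filter fun w => 0 < f w).erase v ∈ L) :
    radial v f ∈ geomReal L := by
  have h := radial_mem_geomSimplex (mem_geomSimplex hf) hv
  exact ⟨h.1, h.2.1, support_radial hv ▸ hL⟩

variable {ι : Type*} [Fintype ι] {K : Set (Finset V)} {v : V}

lemma sphereExt_cone (hK : IsLowerSet K) (hne : K.Nonempty) (hv : ∀ σ ∈ K, insert v σ ∈ K) :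
    SphereExt ι (geomReal K) := by
  obtain ⟨σ, hσ⟩ := hne
  refine sphereExt_starShaped (geomSimplex_subset hK (hv σ hσ)
    (single_mem_geomSimplex (Finset.mem_insert_self v σ))) fun f hf => ?_
  exact ((convex_geomSimplex _).segment_subset (single_mem_geomSimplex (Finset.mem_insert_self v _))
    ⟨hf.1, hf.2.1, fun w hw => (mem_geomSimplex hf).2.2 w fun h =>
      hw (Finset.mem_insert_of_mem h)⟩).trans (geomSimplex_subset hK (hv _ hf.2.2))

lemma sphereExt_of_deletion_of_link {d : ℕ} (hK : IsLowerSet K) (hv : {v} ∈ K)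
    (hdel : ∀ j ≤ d, SphereExt (Fin j) (geomReal {σ ∈ K | v ∉ σ}))
    (hlink : ∀ j < d, SphereExt (Fin j) (geomReal {σ | v ∉ σ ∧ insert v σ ∈ K})) :
    SphereExt (Fin d) (geomReal K) := by
  have hsub : ∀ f ∈ geomReal K, f ∈ geomSimplex (Finset.univ.filter fun w => 0 < f w) ∧
      geomSimplex (Finset.univ.filter fun w => 0 < f w) ⊆ geomReal K :=
    fun f hf => ⟨mem_geomSimplex hf, geomSimplex_subset hK hf.2.2⟩
  refine SphereExt.of_openCover
    (O := fun i => bif i then {f : V → ℝ | f v < 1} else {f : V → ℝ | 0 < f v}) ?_ ?_ ?_ ?_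
  · rintro (_ | _)
    · exact isOpen_lt continuous_const (continuous_apply v)
    · exact isOpen_lt (continuous_apply v) continuous_const
  · intro f _
    rcases lt_or_ge (f v) 1 with h | h
    · exact mem_iUnion.2 ⟨true, h⟩
    · exact mem_iUnion.2 ⟨false, zero_lt_one.trans_le h⟩
  · rintro (_ | _) j hj
    · refine sphereExt_starShaped (x := Pi.single v 1) ⟨geomSimplex_subset hK hv
        (single_mem_geomSimplex (Finset.mem_singleton_self v)), by simp⟩ ?_
      rintro f ⟨hf, hfv⟩
      have hfv : 0 < f v := hfv
      refine subset_inter ?_ ((convex_gt v 0).segment_subset (by simp) hfv)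
      exact ((convex_geomSimplex _).segment_subset (single_mem_geomSimplex (by simpa using hfv))
        (hsub f hf).1).trans (hsub f hf).2
    · refine SphereExt.of_segment (radial v) id ((continuousOn_radial v).mono inter_subset_right)
        ?_ continuousOn_id ?_ ?_ (hdel j hj)
      · rintro f ⟨hf, hfv⟩
        exact radial_mem_geomReal hf hfv
          ⟨hK (Finset.erase_subset _ _) hf.2.2, Finset.notMem_erase _ _⟩
      · rintro f hf
        refine ⟨⟨hf.1, hf.2.1, hf.2.2.1⟩, ?_⟩
        have : f v = 0 := (mem_geomSimplex hf).2.2 v hf.2.2.2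
        simp [this]
      · rintro f ⟨hf, hfv⟩
        refine subset_inter ?_ ((convex_lt v 1).segment_subset (by simp [radial]) hfv)
        refine ((convex_geomSimplex _).segment_subset ?_ (hsub f hf).1).trans (hsub f hf).2
        have h := radial_mem_geomSimplex (hsub f hf).1 hfv
        exact ⟨h.1, h.2.1, fun w hw => h.2.2 w fun h' => hw (Finset.mem_of_mem_erase h')⟩
  · intro j hj
    have hmid : ∀ g : V → ℝ, (2⁻¹ : ℝ) • g + (2⁻¹ : ℝ) • Pi.single v 1 ∈
        segment ℝ g (Pi.single v 1) := fun g =>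
      ⟨2⁻¹, 2⁻¹, by norm_num, by norm_num, by norm_num, rfl⟩
    have hmidv : ∀ g : V → ℝ, g v = 0 → (2⁻¹ : ℝ) • g + (2⁻¹ : ℝ) • Pi.single v 1 ∈
        {f : V → ℝ | f v < 1} ∩ {f : V → ℝ | 0 < f v} := fun g hg => by
      constructor <;> norm_num [hg]
    refine SphereExt.of_segment (radial v) (fun g => (2⁻¹ : ℝ) • g + (2⁻¹ : ℝ) • Pi.single v 1)
      ((continuousOn_radial v).mono fun f hf => hf.2.1) ?_ (by fun_prop) ?_ ?_ (hlink j hj)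
    · rintro f ⟨hf, hfv, hfv'⟩
      have hfv' : 0 < f v := hfv'
      refine radial_mem_geomReal hf hfv ⟨Finset.notMem_erase _ _, ?_⟩
      rw [Finset.insert_erase (by simpa using hfv')]
      exact hf.2.2
    · intro g hg
      have hgs := mem_geomSimplex hg
      refine ⟨?_, hmidv g (hgs.2.2 v hg.2.2.1)⟩
      refine ((convex_geomSimplex _).segment_subset ?_ ?_).trans
        (geomSimplex_subset hK hg.2.2.2) (hmid g)
      · exact ⟨hgs.1, hgs.2.1, fun w hw => hgs.2.2 w fun h => hw (Finset.mem_insert_of_mem h)⟩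
      · exact single_mem_geomSimplex (Finset.mem_insert_self _ _)
    · rintro f ⟨hf, hfv, hfv'⟩
      have hrv := hmidv (radial v f) (by simp [radial])
      refine subset_inter ?_ (subset_inter ((convex_lt v 1).segment_subset hrv.1 hfv)
        ((convex_gt v 0).segment_subset hrv.2 hfv'))
      refine ((convex_geomSimplex _).segment_subset ?_ (hsub f hf).1).trans (hsub f hf).2
      have h := radial_mem_geomSimplex (hsub f hf).1 hfv
      refine (convex_geomSimplex _).segment_subset ?_ ?_ (hmid _)
      · exact ⟨h.1, h.2.1, fun w hw => h.2.2 w fun h' => hw (Finset.mem_of_mem_erase h')⟩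
      · exact single_mem_geomSimplex (by simpa using hfv')

end Simplicial

section Board

variable {C R : Type*} [DecidableEq C] [DecidableEq R]

/-- The sets of squares of the board `B` with at most `k i` squares in row `i` and at most one
square in each column. -/
def boardComplex (B : Finset (C × R)) (k : R → ℕ) : Set (Finset (C × R)) :=
  {A | A ⊆ B ∧ (∀ i, (A.filter fun v => v.2 = i).card ≤ k i) ∧
    ∀ j, (A.filter fun v => v.1 = j).card ≤ 1}

/-- The realization of `K` is `(μ - 2)`-connected, in terms of extension of maps. -/
def ConnBelow {V : Type*} [Fintype V] (μ : ℤ) (K : Set (Finset V)) : Prop :=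
  ∀ j : ℕ, (j : ℤ) < μ → SphereExt (Fin j) (geomReal K)

lemma ConnBelow.mono {V : Type*} [Fintype V] {μ ν : ℤ} {K : Set (Finset V)} (h : ConnBelow μ K)
    (hν : ν ≤ μ) : ConnBelow ν K := fun j hj => h j (hj.trans_le hν)

lemma isLowerSet_boardComplex (B : Finset (C × R)) (k : R → ℕ) :
    IsLowerSet (boardComplex B k) := fun _ _ hA h =>
  ⟨hA.trans h.1, fun i => (Finset.card_le_card (Finset.filter_subset_filter _ hA)).trans (h.2.1 i),
    fun j => (Finset.card_le_card (Finset.filter_subset_filter _ hA)).trans (h.2.2 j)⟩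

lemma empty_mem_boardComplex (B : Finset (C × R)) (k : R → ℕ) : ∅ ∈ boardComplex B k := by
  simp [boardComplex]

lemma boardComplex_eq_of_subset {B B' : Finset (C × R)} {k : R → ℕ} (h : B' ⊆ B)
    (h0 : ∀ v ∈ B, v ∉ B' → k v.2 = 0) : boardComplex B k = boardComplex B' k := by
  ext A
  refine ⟨fun hA => ⟨fun v hv => ?_, hA.2⟩, fun hA => ⟨hA.1.trans h, hA.2⟩⟩
  by_contra hv'
  have h1 := hA.2.1 v.2
  rw [h0 v (hA.1 hv) hv', Nat.le_zero, Finset.card_eq_zero] at h1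
  exact (Finset.eq_empty_iff_forall_notMem.1 h1) v (by simpa using hv)

lemma boardComplex_deletion (B : Finset (C × R)) (k : R → ℕ) (v : C × R) :
    {σ ∈ boardComplex B k | v ∉ σ} = boardComplex (B.erase v) k := by
  ext A
  simp only [boardComplex, mem_ofPred_eq, Finset.subset_erase]
  tauto

lemma boardComplex_link {B : Finset (C × R)} {k : R → ℕ} {v : C × R} (hv : v ∈ B)
    (hk : 0 < k v.2) : {σ | v ∉ σ ∧ insert v σ ∈ boardComplex B k} =
      boardComplex (B.filter fun w => w.1 ≠ v.1) (Function.update k v.2 (k v.2 - 1)) := by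
  ext A
  simp only [boardComplex, mem_ofPred_eq, Finset.insert_subset_iff, hv, true_and,
    Finset.filter_insert]
  constructor
  · rintro ⟨hvA, hAB, hr, hc⟩
    refine ⟨fun w hw => Finset.mem_filter.2 ⟨hAB hw, fun hwv => ?_⟩, fun i => ?_, fun j => ?_⟩
    · have h := hc v.1
      rw [if_pos rfl, Finset.card_insert_of_notMem (by simp [hvA])] at h
      have : A.filter (fun u => u.1 = v.1) = ∅ := Finset.card_eq_zero.1 (by omega)
      exact (Finset.eq_empty_iff_forall_notMem.1 this) w (by simp [hw, hwv])
    · have h := hr i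
      rcases eq_or_ne i v.2 with rfl | hi
      · rw [if_pos rfl, Finset.card_insert_of_notMem (by simp [hvA])] at h
        rw [Function.update_self]
        omega
      · rw [if_neg hi.symm] at h
        rwa [Function.update_of_ne hi]
    · refine le_trans (Finset.card_le_card ?_) (hc j)
      split_ifs
      · exact Finset.subset_insert _ _
      · exact subset_rfl
  · rintro ⟨hAB, hr, hc⟩
    have hvA : v ∉ A := fun h => by simpa using hAB h
    refine ⟨hvA, hAB.trans (Finset.filter_subset _ _), fun i => ?_, fun j => ?_⟩
    · have h := hr i
      rcases eq_or_ne i v.2 with rfl | hi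
      · rw [if_pos rfl, Finset.card_insert_of_notMem (by simp [hvA])]
        rw [Function.update_self] at h
        omega
      · rw [if_neg hi.symm]
        rwa [Function.update_of_ne hi] at h
    · split_ifs with h
      · have : A.filter (fun u => u.1 = j) = ∅ := by
          refine Finset.filter_eq_empty_iff.2 fun w hw hwj => ?_
          exact (Finset.mem_filter.1 (hAB hw)).2 (hwj.trans h.symm)
        simp [this]
      · exact hc j

variable [Fintype C] [Fintype R]

lemma connBelow_boardComplex_of_erase {B : Finset (C × R)} {k : R → ℕ} {v : C × R} {μ : ℤ}
    (hv : v ∈ B) (hdel : ConnBelow μ (boardComplex (B.erase v) k))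
    (hlink : 0 < k v.2 → ConnBelow (μ - 1)
      (boardComplex (B.filter fun w => w.1 ≠ v.1) (Function.update k v.2 (k v.2 - 1)))) :
    ConnBelow μ (boardComplex B k) := by
  rcases Nat.eq_zero_or_pos (k v.2) with h0 | hpos
  · rwa [boardComplex_eq_of_subset (Finset.erase_subset v B)]
    intro w hw hw'
    rw [Finset.mem_erase, not_and_or, not_not] at hw'
    rcases hw' with rfl | h
    · exact h0
    · exact absurd hw h
  · intro d hd
    have hlk := boardComplex_link hv hpos
    refine sphereExt_of_deletion_of_link (v := v) (isLowerSet_boardComplex B k) ?_ ?_ ?_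
    · have : (∅ : Finset (C × R)) ∈ {σ | v ∉ σ ∧ insert v σ ∈ boardComplex B k} :=
        hlk ▸ empty_mem_boardComplex _ _
      simpa using this.2
    · intro j hj
      rw [boardComplex_deletion]
      exact hdel j (by omega)
    · intro j hj
      rw [hlk]
      exact hlink hpos j (by omega)

lemma connBelow_boardComplex_of_cone {B : Finset (C × R)} {k : R → ℕ} {v : C × R} (hv : v ∈ B)
    (hrow : ∀ w ∈ B, w.2 = v.2 → w = v) (hcol : ∀ w ∈ B, w.1 = v.1 → w = v) (hk : 0 < k v.2)
    (μ : ℤ) : ConnBelow μ (boardComplex B k) := by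
  refine fun j _ => sphereExt_cone (v := v) (isLowerSet_boardComplex B k)
    ⟨∅, empty_mem_boardComplex B k⟩ fun A hA => ?_
  have hins : insert v A ⊆ B := Finset.insert_subset hv hA.1
  have key : ∀ p : C × R → Prop, ∀ [DecidablePred p], (∀ w ∈ B, p w → w = v) →
      ((insert v A).filter p).card ≤ 1 := fun p _ hp => by
    refine Finset.card_le_one.2 fun a ha b hb => ?_
    rw [Finset.mem_filter] at ha hb
    rw [hp a (hins ha.1) ha.2, hp b (hins hb.1) hb.2]
  refine ⟨hins, fun i => ?_, fun j => ?_⟩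
  · rcases eq_or_ne v.2 i with rfl | hi
    · exact (key _ hrow).trans hk
    · rw [Finset.filter_insert, if_neg hi]
      exact hA.2.1 i
  · rcases eq_or_ne v.1 j with rfl | hj
    · exact key _ hcol
    · rw [Finset.filter_insert, if_neg hj]
      exact hA.2.2 j

/-- If the bound is known for the rows `Q`, it holds after adding a row `r` with squares in some of
the columns of the board and in one further column `c`. -/
lemma connBelow_boardComplex_extraRow {Q : Finset R} {r : R} (hr : r ∉ Q)
    (hQ : ∀ (D : Finset C) (k : R → ℕ),
      ConnBelow (min ((D.card : ℤ) - Q.card + 1) (∑ i ∈ Q, (k i : ℤ))) (boardComplex (D ×ˢ Q) k))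
    {c : C} (T : Finset C) : ∀ (D : Finset C) (k : R → ℕ), T ⊆ D → c ∉ D →
      ConnBelow (min ((D.card : ℤ) - Q.card + 1) (∑ i ∈ Q, (k i : ℤ) + k r))
        (boardComplex (D ×ˢ Q ∪ insert c T ×ˢ {r}) k) := by
  have hzero : ∀ (T D : Finset C) (k : R → ℕ), k r = 0 →
      ConnBelow (min ((D.card : ℤ) - Q.card + 1) (∑ i ∈ Q, (k i : ℤ) + k r))
        (boardComplex (D ×ˢ Q ∪ insert c T ×ˢ {r}) k) := by
    intro T D k hk
    rw [boardComplex_eq_of_subset (B' := D ×ˢ Q) Finset.subset_union_left]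
    · simpa [hk] using hQ D k
    · rintro ⟨a, b⟩ hv hv'
      rw [Finset.mem_union] at hv
      have := hv.resolve_left hv'
      simp only [Finset.mem_product, Finset.mem_singleton] at this
      rw [this.2, hk]
  induction T using Finset.induction_on with
  | empty =>
    intro D k _ hc
    rcases Nat.eq_zero_or_pos (k r) with h0 | hpos
    · exact hzero _ D k h0
    · refine connBelow_boardComplex_of_cone (v := (c, r)) (by simp) ?_ ?_ hpos _
      · rintro ⟨a, b⟩ hv rfl
        simpa [hr] using hv
      · rintro ⟨a, b⟩ hv rfl
        simpa [hc] using hv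
  | insert t T ht ih =>
    intro D k hTD hc
    have htD : t ∈ D := hTD (Finset.mem_insert_self _ _)
    have hTD' : T ⊆ D := (Finset.subset_insert _ _).trans hTD
    have htc : t ≠ c := fun h => hc (h ▸ htD)
    rcases Nat.eq_zero_or_pos (k r) with h0 | hpos
    · exact hzero _ D k h0
    · refine connBelow_boardComplex_of_erase (v := (t, r)) (by simp) ?_ fun _ => ?_
      · convert ih D k hTD' hc using 2
        ext ⟨a, b⟩
        simp only [Finset.mem_erase, Finset.mem_union, Finset.mem_product, Finset.mem_insert,
          Finset.mem_singleton, ne_eq, Prod.mk.injEq]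
        grind
      · have h := ih (D.erase t) (Function.update k r (k r - 1))
          (fun x hx => Finset.mem_erase.2 ⟨fun h => ht (h ▸ hx), hTD' hx⟩)
          (fun h => hc (Finset.mem_of_mem_erase h))
        have hset : (D ×ˢ Q ∪ insert c (insert t T) ×ˢ {r}).filter (fun w => w.1 ≠ t) =
            D.erase t ×ˢ Q ∪ insert c T ×ˢ {r} := by
          ext ⟨a, b⟩
          simp only [Finset.mem_erase, Finset.mem_union, Finset.mem_product, Finset.mem_insert,
            Finset.mem_singleton, Finset.mem_filter, ne_eq]
          grind
        have hsum : ∑ i ∈ Q, ((Function.update k r (k r - 1) i : ℕ) : ℤ) = ∑ i ∈ Q, (k i : ℤ) :=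
          Finset.sum_congr rfl fun i hi => by
            rw [Function.update_of_ne (by rintro rfl; exact hr hi)]
        rw [hset]
        refine h.mono ?_
        rw [hsum, Function.update_self, Finset.card_erase_of_mem htD]
        have := Finset.card_pos.2 ⟨t, htD⟩
        omega

lemma connBelow_boardComplex (Q : Finset R) : ∀ (D : Finset C) (k : R → ℕ),
    ConnBelow (min ((D.card : ℤ) - Q.card + 1) (∑ i ∈ Q, (k i : ℤ))) (boardComplex (D ×ˢ Q) k) := by
  induction Q using Finset.strongInduction with
  | H Q ihQ =>
  intro D
  induction D using Finset.induction_on with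
  | empty =>
    intro k j hj
    rcases Q.eq_empty_or_nonempty with rfl | hne
    · simp at hj
      omega
    · have := Finset.card_pos.2 hne
      simp only [Finset.card_empty] at hj
      omega
  | insert c D hc ihD =>
    intro k
    by_cases hzero : ∀ i ∈ Q, k i = 0
    · intro j hj
      rw [Finset.sum_eq_zero fun i hi => by simp [hzero i hi]] at hj
      omega
    push Not at hzero
    obtain ⟨r, hrQ, hkr⟩ := hzero
    have hcard := Finset.card_erase_of_mem hrQ
    have hpos := Finset.card_pos.2 ⟨r, hrQ⟩
    have key : ∀ P ⊆ Q.erase r, ConnBelow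
        (min (((insert c D).card : ℤ) - Q.card + 1) (∑ i ∈ Q, (k i : ℤ)))
        (boardComplex (D ×ˢ Q ∪ {c} ×ˢ insert r P) k) := by
      intro P
      induction P using Finset.induction_on with
      | empty =>
        intro _
        have h := connBelow_boardComplex_extraRow (Finset.notMem_erase r Q)
          (ihQ _ (Finset.erase_ssubset hrQ)) D D k subset_rfl hc
        have hset : D ×ˢ Q.erase r ∪ insert c D ×ˢ {r} = D ×ˢ Q ∪ {c} ×ˢ insert r ∅ := by
          ext ⟨a, b⟩
          simp only [Finset.mem_erase, Finset.mem_union, Finset.mem_product, Finset.mem_insert,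
            Finset.mem_singleton, Finset.notMem_empty, ne_eq]
          grind
        rw [hset, Finset.sum_erase_add _ _ hrQ] at h
        refine h.mono ?_
        rw [Finset.card_insert_of_notMem hc]
        omega
      | insert q P hq ihP =>
        intro hP
        have hqQ := hP (Finset.mem_insert_self q P)
        have hqr := Finset.ne_of_mem_erase hqQ
        have hqQ := Finset.mem_of_mem_erase hqQ
        refine connBelow_boardComplex_of_erase (v := (c, q)) (by simp) ?_ fun hkq => ?_
        · convert ihP ((Finset.subset_insert _ _).trans hP) using 2
          ext ⟨a, b⟩
          simp only [Finset.mem_erase, Finset.mem_union, Finset.mem_product, Finset.mem_insert,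
            Finset.mem_singleton, ne_eq, Prod.mk.injEq]
          grind
        · have hset : (D ×ˢ Q ∪ {c} ×ˢ insert r (insert q P)).filter (fun w => w.1 ≠ c) =
              D ×ˢ Q := by
            ext ⟨a, b⟩
            simp only [Finset.mem_union, Finset.mem_product, Finset.mem_insert,
              Finset.mem_singleton, Finset.mem_filter, ne_eq]
            grind
          rw [hset]
          refine (ihD (Function.update k q (k q - 1))).mono ?_
          have hsum : ∑ i ∈ Q, ((Function.update k q (k q - 1) i : ℕ) : ℤ) =
              ∑ i ∈ Q, (k i : ℤ) - 1 := by
            rw [← Finset.sum_erase_add _ _ hqQ, ← Finset.sum_erase_add _ _ hqQ,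
              Function.update_self, Finset.sum_congr rfl fun i hi => by
                rw [Function.update_of_ne (Finset.ne_of_mem_erase hi)]]
            dsimp only at hkq
            push_cast [Nat.cast_sub (show 1 ≤ k q from hkq)]
            ring
          rw [hsum, Finset.card_insert_of_notMem hc]
          push_cast
          omega
    have hset : D ×ˢ Q ∪ {c} ×ˢ insert r (Q.erase r) = insert c D ×ˢ Q := by
      ext ⟨a, b⟩
      rw [Finset.insert_erase hrQ]
      simp only [Finset.mem_union, Finset.mem_product, Finset.mem_insert, Finset.mem_singleton]
      tauto
    exact hset ▸ key _ subset_rfl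

end Board

section HomotopyGroup

open scoped unitInterval

variable {E : Type*} [TopologicalSpace E] {X : Set E}

lemma SphereExt.nonempty [Nonempty E] (h : SphereExt (Fin 0) X) : Nonempty X := by
  have h0 : sphere (0 : Fin 0 → ℝ) 1 = ∅ := by
    ext x
    rw [mem_sphere_zero_iff_norm, Subsingleton.elim x 0, norm_zero]
    simp
  obtain ⟨g, _, hg, _⟩ := h (fun _ => Classical.arbitrary E) (h0 ▸ continuousOn_empty _)
    (h0 ▸ mapsTo_empty _ _)
  exact ⟨⟨g 0, hg (by simp)⟩⟩

lemma SphereExt.pathConnectedSpace (hne : Nonempty X) (h : SphereExt (Fin 1) X) :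
    PathConnectedSpace X := by
  refine ⟨hne, fun x y => ?_⟩
  have hs : ∀ u ∈ sphere (0 : Fin 1 → ℝ) 1, u 0 = 1 ∨ u 0 = -1 := fun u hu => by
    rw [mem_sphere_zero_iff_norm] at hu
    have : ‖u‖ = |u 0| := by simp [Pi.norm_def]
    exact (abs_eq zero_le_one).1 (this ▸ hu)
  obtain ⟨g, hg, hgX, hgf⟩ := h (fun u => if u 0 < 0 then x else y) (by
      have h1 : ContinuousOn (fun u : Fin 1 → ℝ => if u 0 < 0 then (x : E) else y)
          ({u | u 0 = 1} ∪ {u | u 0 = -1}) := by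
        refine ContinuousOn.union_of_isClosed ?_ ?_ (isClosed_eq (by fun_prop) (by fun_prop))
          (isClosed_eq (by fun_prop) (by fun_prop))
        · refine (continuousOn_const (c := (y : E))).congr fun u (hu : u 0 = 1) => ?_
          simp only [hu]; norm_num
        · refine (continuousOn_const (c := (x : E))).congr fun u (hu : u 0 = -1) => ?_
          simp only [hu]; norm_num
      exact h1.mono hs)
    (fun u _ => by dsimp only; split_ifs <;> exact Subtype.coe_prop _)
  have hmem : ∀ t : I, (fun _ => 2 * (t : ℝ) - 1 : Fin 1 → ℝ) ∈ closedBall (0 : Fin 1 → ℝ) 1 := by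
    intro t
    have h0 := t.2.1
    have h1 := t.2.2
    rw [mem_closedBall_zero_iff, pi_norm_le_iff_of_nonneg zero_le_one]
    intro _
    rw [Real.norm_eq_abs, abs_le]
    constructor <;> linarith
  refine ⟨⟨⟨fun t => ⟨g fun _ => 2 * (t : ℝ) - 1, hgX (hmem t)⟩, ?_⟩, ?_, ?_⟩⟩
  · exact (hg.comp_continuous (by fun_prop) hmem).subtype_mk _
  · refine Subtype.ext ?_
    have : (fun _ => 2 * ((0 : I) : ℝ) - 1 : Fin 1 → ℝ) ∈ sphere (0 : Fin 1 → ℝ) 1 := by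
      simp [Pi.norm_def]
    simpa using hgf this
  · refine Subtype.ext ?_
    have : (fun _ => 2 * ((1 : I) : ℝ) - 1 : Fin 1 → ℝ) ∈ sphere (0 : Fin 1 → ℝ) 1 := by
      simp [Pi.norm_def]; norm_num
    refine (hgf this).trans ?_
    norm_num

lemma SphereExt.subsingleton_homotopyGroup {i : ℕ} (h : SphereExt (Fin (i + 1)) X) (x : X) :
    Subsingleton (HomotopyGroup (Fin i) X x) := by
  have main : ∀ p : GenLoop (Fin i) X x, GenLoop.Homotopic p GenLoop.const := by
    intro p
    let q : (Fin (i + 1) → ℝ) → E := fun u =>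
      p fun t => projIcc (0 : ℝ) 1 zero_le_one ((u t.succ + 1) / 2)
    have hq : Continuous q := by
      refine continuous_subtype_val.comp (p.1.continuous.comp (continuous_pi fun t => ?_))
      exact continuous_projIcc.comp (by fun_prop)
    have hqx : ∀ u : Fin (i + 1) → ℝ, (∃ t : Fin i, |u t.succ| = 1) → q u = x := by
      rintro u ⟨t, ht⟩
      refine congrArg Subtype.val (p.2 _ ⟨t, ?_⟩)
      rcases (abs_eq zero_le_one).1 ht with h | h
      · right; simp [h]
      · left; simp [h]
    let f : (Fin (i + 1) → ℝ) → E := fun u => if u 0 = -1 then q u else x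
    have hfx : ∀ u : Fin (i + 1) → ℝ, (u 0 = 1 ∨ ∃ t : Fin i, |u t.succ| = 1) → f u = x := by
      intro u hu
      by_cases h0 : u 0 = -1
      · rcases hu with hu | hu
        · norm_num [hu] at h0
        · simp only [f, if_pos h0]; exact hqx u hu
      · simp only [f, if_neg h0]
    have hs : ∀ u ∈ sphere (0 : Fin (i + 1) → ℝ) 1,
        u 0 = -1 ∨ u 0 = 1 ∨ ∃ t : Fin i, |u t.succ| = 1 := by
      intro u hu
      rw [mem_sphere_zero_iff_norm] at hu
      by_contra! hcon
      have hle : ∀ t, |u t| ≤ 1 := fun t => hu ▸ norm_le_pi_norm u t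
      have : ‖u‖ < 1 := by
        rw [pi_norm_lt_iff one_pos]
        refine Fin.cases ?_ fun t => lt_of_le_of_ne (hle _) (hcon.2.2 t)
        refine lt_of_le_of_ne (hle _) fun h => ?_
        rcases (abs_eq zero_le_one).1 h with h | h
        · exact hcon.2.1 h
        · exact hcon.1 h
      exact this.ne hu
    obtain ⟨g, hg, hgX, hgf⟩ := h f (by
        refine ContinuousOn.mono (s := {u : Fin (i + 1) → ℝ | u 0 = -1} ∪
          {u | u 0 = 1 ∨ ∃ t : Fin i, |u t.succ| = 1}) ?_ hs
        refine ContinuousOn.union_of_isClosed ?_ ?_ (isClosed_eq (by fun_prop) (by fun_prop)) ?_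
        · exact hq.continuousOn.congr fun u (hu : u 0 = -1) => if_pos hu
        · exact continuousOn_const.congr hfx
        · refine (isClosed_eq (by fun_prop) (by fun_prop)).union ?_
          have : {u : Fin (i + 1) → ℝ | ∃ t : Fin i, |u t.succ| = 1} =
              ⋃ t : Fin i, {u | |u t.succ| = 1} := by ext; simp
          change IsClosed {u : Fin (i + 1) → ℝ | ∃ t : Fin i, |u t.succ| = 1}
          rw [this]
          exact isClosed_iUnion_of_finite fun t => isClosed_eq (by fun_prop) (by fun_prop))
      (fun u _ => by
        simp only [f]
        split_ifs <;> exact Subtype.coe_prop _)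
    let c : I × (Fin i → I) → Fin (i + 1) → ℝ := fun z =>
      Fin.cons (2 * (z.1 : ℝ) - 1) fun t => 2 * (z.2 t : ℝ) - 1
    have hcc : Continuous c := by
      refine continuous_pi (Fin.cases ?_ fun t => ?_)
      · simp only [c, Fin.cons_zero]; fun_prop
      · simp only [c, Fin.cons_succ]; fun_prop
    have habs : ∀ s : I, |2 * (s : ℝ) - 1| ≤ 1 := fun s => by
      have h0 := s.2.1
      have h1 := s.2.2
      rw [abs_le]
      constructor <;> linarith
    have hcle : ∀ z, ‖c z‖ ≤ 1 := by
      intro z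
      rw [pi_norm_le_iff_of_nonneg zero_le_one]
      refine Fin.cases ?_ fun t => ?_
      · exact habs z.1
      · exact habs (z.2 t)
    have hcball : ∀ z, c z ∈ closedBall (0 : Fin (i + 1) → ℝ) 1 := by simpa using hcle
    have hcs : ∀ z t, |c z t| = 1 → c z ∈ sphere (0 : Fin (i + 1) → ℝ) 1 := fun z t h => by
      rw [mem_sphere_zero_iff_norm]
      exact le_antisymm (hcle z) (h ▸ norm_le_pi_norm (c z) t)
    have hbd : ∀ z : I × (Fin i → I), z.2 ∈ Cube.boundary (Fin i) → g (c z) = x := by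
      rintro z ⟨t, ht⟩
      have : |c z t.succ| = 1 := by
        simp only [c, Fin.cons_succ]
        rcases ht with h | h <;> rw [h] <;> norm_num
      rw [hgf (hcs z _ this)]
      exact hfx _ (Or.inr ⟨t, this⟩)
    refine ⟨⟨⟨⟨fun z => ⟨g (c z), hgX (hcball z)⟩,
      (hg.comp_continuous hcc hcball).subtype_mk _⟩, fun y => ?_, fun y => ?_⟩, fun s y hy => ?_⟩⟩
    · refine Subtype.ext ?_
      have h0 : c (0, y) 0 = -1 := by simp [c]
      change g (c (0, y)) = p y
      rw [hgf (hcs _ 0 (by rw [h0]; norm_num))]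
      simp only [f, if_pos h0, q]
      congr 2
      funext t
      simp [c]
    · refine Subtype.ext ?_
      have h0 : c (1, y) 0 = 1 := by simp [c]; norm_num
      change g (c (1, y)) = x
      rw [hgf (hcs _ 0 (by rw [h0]; norm_num))]
      exact hfx _ (Or.inl h0)
    · refine Subtype.ext ?_
      change g (c (s, y)) = p y
      exact (hbd (s, y) hy).trans (congrArg Subtype.val (p.2 y hy)).symm
  refine ⟨fun a b => Quotient.inductionOn₂ a b fun p q => Quotient.sound ?_⟩
  exact (main p).trans (main q).symm

end HomotopyGroup

lemma realization_eq_geomReal (m n : ℕ) (k : Fin n → ℕ) :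
    Realization m n k (fun _ => 1) = geomReal (boardComplex (Finset.univ ×ˢ Finset.univ) k) := by
  ext f
  constructor
  · rintro ⟨h1, h2, h3⟩
    exact ⟨fun v => (h1 v).1, h2, by simp, h3.1, h3.2⟩
  · rintro ⟨h1, h2, h3⟩
    exact ⟨fun v => ⟨h1 v, h2 ▸ Finset.single_le_sum (fun w _ => h1 w) (Finset.mem_univ v)⟩, h2,
      h3.2.1, h3.2.2⟩

theorem connectivity_of_multiple_chessboard_complex
    (m n : ℕ) (hm : 1 ≤ m) (hn : 1 ≤ n) (k : Fin n → ℕ) (hk : ∀ i, 1 ≤ k i)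
    (μ : ℤ) (hμdef : μ = min ((m : ℤ) - (n : ℤ) + 1) (∑ i, (k i : ℤ)))
    (hμ : 1 ≤ μ) :
    CConnected (μ - 2) ↥(Realization m n k fun _ => 1) ∧
    ((∑ i, k i) + n - 1 ≤ m →
      CConnected ((∑ i, (k i : ℤ)) - 2) ↥(Realization m n k fun _ => 1)) := by
  have hmain : CConnected (μ - 2) ↥(Realization m n k fun _ => 1) := by
    have h : ConnBelow μ (boardComplex (Finset.univ ×ˢ Finset.univ : Finset (Fin m × Fin n)) k) := by
      simpa [hμdef] using connBelow_boardComplex (Finset.univ : Finset (Fin n))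
        (Finset.univ : Finset (Fin m)) k
    rw [realization_eq_geomReal]
    have hne := (h 0 (by omega)).nonempty
    refine ⟨hne, fun h0 => (h 1 (by omega)).pathConnectedSpace hne, fun i _ hi x => ?_⟩
    exact (h (i + 1) (by omega)).subsingleton_homotopyGroup x
  refine ⟨hmain, fun hle => ?_⟩
  have hsum : ((∑ i, k i : ℕ) : ℤ) = ∑ i, (k i : ℤ) := by push_cast; rfl
  have : μ = ∑ i, (k i : ℤ) := by omega
  rwa [← this]
end

section
/- Let m, n ≥ 1 and let k_1, …, k_n be positive integers. If m ≥ n + 2 and k_1 + ⋯ + k_n ≥ 3, then the geometric realization of the multiple chessboard complex Δ_{m,n}^{k_1,…,k_n;1} is simply connected, i.e. it is path-connected and its fundamental group is trivial. -/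
open scoped BigOperators

open CategoryTheory

/-- A system of objects indexed by the vertices of a simplicial complex and morphisms indexed by
its edges which is compatible with composition along the triangles. -/
structure FlatSystem {V : Type*} [DecidableEq V] (K : Finset V → Prop)
    (C : Type*) [Category C] where
  obj : V → C
  hom : ∀ {u v : V}, K {u, v} → (obj u ⟶ obj v)
  comp : ∀ {u v w : V} (huv : K {u, v}) (hvw : K {v, w}) (huw : K {u, w}),
    K {u, v, w} → hom huv ≫ hom hvw = hom huw

/-- A flat system is trivializable if the objects can be reached from a common object
compatibly with the morphisms along the edges. -/
def FlatSystem.Trivializable {V : Type*} [DecidableEq V] {K : Finset V → Prop}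
    {C : Type*} [Category C] (E : FlatSystem K C) : Prop :=
  ∃ (c : C) (p : ∀ v, c ⟶ E.obj v), ∀ (u v : V) (h : K {u, v}), p u ≫ E.hom h = p v

section Faces

variable {m n : ℕ} {k : Fin n → ℕ} {l : Fin m → ℕ} {A B : Finset (Fin m × Fin n)}

theorem IsFace.mono (hA : IsFace m n k l A) (hBA : B ⊆ A) : IsFace m n k l B :=
  ⟨fun i => (Finset.card_le_card (Finset.filter_subset_filter _ hBA)).trans (hA.1 i),
    fun j => (Finset.card_le_card (Finset.filter_subset_filter _ hBA)).trans (hA.2 j)⟩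

theorem IsFace.fst_ne {u v : Fin m × Fin n} (hA : IsFace m n k (fun _ => 1) A)
    (hu : u ∈ A) (hv : v ∈ A) (huv : u ≠ v) : u.1 ≠ v.1 := by
  intro h
  have := Finset.card_le_one.1 (hA.2 v.1) u (by simp [hu, h]) v (by simp [hv])
  exact huv this

theorem isFace_empty : IsFace m n k l ∅ := by simp [IsFace]

theorem IsFace.insert {x : Fin m × Fin n} (hA : IsFace m n k l A)
    (h₁ : ∀ v ∈ A, v.1 ≠ x.1) (h₂ : ∀ v ∈ A, v.2 ≠ x.2) (hk : 1 ≤ k x.2) (hl : 1 ≤ l x.1) :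
    IsFace m n k l (insert x A) := by
  constructor
  · intro i
    rw [Finset.filter_insert]
    split_ifs with h
    · subst h
      rw [Finset.filter_false_of_mem h₂]
      simpa using hk
    · exact hA.1 i
  · intro j
    rw [Finset.filter_insert]
    split_ifs with h
    · subst h
      rw [Finset.filter_false_of_mem h₁]
      simpa using hl
    · exact hA.2 j

theorem isFace_of_card_le {i : Fin n} (hA : ∀ v ∈ A, v.2 = i) (hk : A.card ≤ k i)
    (hl : ∀ j, 1 ≤ l j) : IsFace m n k l A := by
  constructor
  · intro i'
    by_cases h : i' = i
    · subst h
      exact (Finset.card_filter_le _ _).trans hk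
    · rw [Finset.filter_false_of_mem (fun v hv hvi => h (hvi.symm.trans (hA v hv)))]
      simp
  · intro j
    refine (Finset.card_le_one.2 fun u hu v hv => ?_).trans (hl j)
    simp only [Finset.mem_filter] at hu hv
    exact Prod.ext (hu.2.trans hv.2.symm) ((hA u hu.1).trans (hA v hv.1).symm)

theorem Fin.exists_notMem_of_card_lt {s : Finset (Fin m)} (hs : s.card < m) : ∃ a, a ∉ s := by
  by_contra! h
  have := Finset.card_le_card (fun a _ => h a : Finset.univ ⊆ s)
  simp at this
  omega

theorem exists_fin_ne₃ (hm : 4 ≤ m) (a b c : Fin m) : ∃ d, d ≠ a ∧ d ≠ b ∧ d ≠ c := by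
  obtain ⟨d, hd⟩ := Fin.exists_notMem_of_card_lt
    (s := {a, b, c}) (Finset.card_le_three.trans_lt (by omega))
  exact ⟨d, by simpa using hd⟩

theorem exists_fin_ne₄ (hm : 5 ≤ m) (a b c d : Fin m) :
    ∃ e, e ≠ a ∧ e ≠ b ∧ e ≠ c ∧ e ≠ d := by
  obtain ⟨e, he⟩ := Fin.exists_notMem_of_card_lt
    (s := {a, b, c, d}) (Finset.card_le_four.trans_lt (by omega))
  exact ⟨e, by simpa using he⟩

/-- The complex obtained by deleting the row `r` and the columns `a`, `b` is connected: a property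
which propagates along its edges passes from any of its vertices to any other. -/
theorem induction_along_edges (hmn : n + 2 ≤ m) (hk : ∀ i, 1 ≤ k i) {r : Fin n} {a b : Fin m}
    (hr : ∀ i, i ≠ r → 2 ≤ k i ∨ ∃ j, j ≠ i ∧ j ≠ r)
    {P : Fin m × Fin n → Prop}
    (hP : ∀ u v : Fin m × Fin n, (u.1 ≠ a ∧ u.1 ≠ b ∧ u.2 ≠ r) → (v.1 ≠ a ∧ v.1 ≠ b ∧ v.2 ≠ r) →
      IsFace m n k (fun _ => 1) {u, v} → P u → P v)
    {u v : Fin m × Fin n} (hu : u.1 ≠ a ∧ u.1 ≠ b ∧ u.2 ≠ r) (hv : v.1 ≠ a ∧ v.1 ≠ b ∧ v.2 ≠ r)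
    (h : P u) : P v := by
  have edge : ∀ x y : Fin m × Fin n, x.1 ≠ y.1 → x.2 ≠ y.2 →
      IsFace m n k (fun _ => 1) {x, y} := fun x y h₁ h₂ =>
    IsFace.insert (isFace_empty.insert (by simp) (by simp) (hk _) le_rfl)
      (by simpa using h₁.symm) (by simpa using h₂.symm) (hk _) le_rfl
  have five : ∀ i j : Fin n, i ≠ j → i ≠ r → j ≠ r → 5 ≤ m := by
    intro i j hij hi hj
    have := Finset.card_le_univ ({i, j, r} : Finset (Fin n))
    rw [Finset.card_eq_three.2 ⟨i, j, r, hij, hi, hj, rfl⟩, Fintype.card_fin] at this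
    omega
  have same : ∀ x y : Fin m × Fin n, (x.1 ≠ a ∧ x.1 ≠ b ∧ x.2 ≠ r) →
      (y.1 ≠ a ∧ y.1 ≠ b ∧ y.2 ≠ r) → x.2 = y.2 → P x → P y := by
    intro x y hx hy hxy hPx
    rcases hr x.2 hx.2.2 with h2 | ⟨j, hj, hjr⟩
    · exact hP x y hx hy (isFace_of_card_le (i := x.2) (by simp [hxy])
        (Finset.card_le_two.trans h2) fun _ => le_rfl) hPx
    · obtain ⟨d, hda, hdb, hdx, hdy⟩ := exists_fin_ne₄ (five _ _ hj hjr hx.2.2) a b x.1 y.1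
      exact hP (d, j) y ⟨hda, hdb, hjr⟩ hy (edge _ _ hdy (hxy ▸ hj))
        (hP x (d, j) hx ⟨hda, hdb, hjr⟩ (edge _ _ hdx.symm hj.symm) hPx)
  by_cases huv : u.2 = v.2
  · exact same u v hu hv huv h
  · obtain ⟨d, hda, hdb, hdu, -⟩ :=
      exists_fin_ne₄ (five _ _ huv hu.2.2 hv.2.2) a b u.1 v.1
    exact same (d, v.2) v ⟨hda, hdb, hv.2.2⟩ hv rfl
      (hP u (d, v.2) hu ⟨hda, hdb, hv.2.2⟩ (edge _ _ hdu.symm huv) h)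

end Faces

section Trivialization

variable {m n : ℕ} {k : Fin n → ℕ} {C : Type*} [Groupoid C]

/-- With a single row of capacity at least three, every triangle is a face. -/
theorem trivializable_of_one_row {i : Fin n} (hi : ∀ j, j = i) (hm : 0 < m) (hk : 3 ≤ k i)
    (E : FlatSystem (IsFace m n k fun _ => 1) C) : E.Trivializable := by
  have face : ∀ u v w : Fin m × Fin n, IsFace m n k (fun _ => 1) {u, v, w} := fun u v w =>
    isFace_of_card_le (i := i) (fun x _ => hi x.2) (Finset.card_le_three.trans hk)
      fun _ => le_rfl
  have edge : ∀ u v : Fin m × Fin n, IsFace m n k (fun _ => 1) {u, v} := fun u v =>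
    (face u v v).mono (by simp)
  exact ⟨E.obj (⟨0, hm⟩, i), fun v => E.hom (edge _ v),
    fun u v h => E.comp _ _ _ (face _ u v)⟩

/-- Flat systems are trivializable if, after deleting the row `r` and any two columns, the complex
stays connected. -/
theorem trivializable_of_row (hn : 2 ≤ n) (hmn : n + 2 ≤ m) (hk : ∀ i, 1 ≤ k i) {r : Fin n}
    (hr : ∀ i, i ≠ r → 2 ≤ k i ∨ ∃ j, j ≠ i ∧ j ≠ r)
    (E : FlatSystem (IsFace m n k fun _ => 1) C) : E.Trivializable := by
  obtain ⟨s, hs⟩ : ∃ s : Fin n, s ≠ r := by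
    have : Nontrivial (Fin n) := Fin.nontrivial_iff_two_le.2 hn
    exact exists_ne r
  -- adding a vertex of the row `r` in a new column
  have coneRow : ∀ (a : Fin m) (u v : Fin m × Fin n), u.1 ≠ a → v.1 ≠ a → u.2 ≠ r → v.2 ≠ r →
      IsFace m n k (fun _ => 1) {u, v} → IsFace m n k (fun _ => 1) {(a, r), u, v} :=
    fun a u v hu hv hur hvr h =>
      h.insert (by simp [hu, hv]) (by simp [hur, hvr]) (hk _) le_rfl
  have single : ∀ u : Fin m × Fin n, IsFace m n k (fun _ => 1) {u} := fun u =>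
    isFace_empty.insert (by simp) (by simp) (hk _) le_rfl
  have cone : ∀ {a : Fin m} {u : Fin m × Fin n}, u.1 ≠ a → u.2 ≠ r →
      IsFace m n k (fun _ => 1) {(a, r), u} := fun hu hur =>
    (single _).insert (by simp [hu]) (by simp [hur]) (hk _) le_rfl
  have cone' : ∀ {a : Fin m} {u : Fin m × Fin n}, u.1 ≠ a → u.2 ≠ r →
      IsFace m n k (fun _ => 1) {u, (a, r)} := fun hu hur => by
    rw [Finset.pair_comm]; exact cone hu hur
  have indep : ∀ (a b : Fin m) (u v : Fin m × Fin n)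
      (hua : u.1 ≠ a) (hub : u.1 ≠ b) (hur : u.2 ≠ r)
      (hva : v.1 ≠ a) (hvb : v.1 ≠ b) (hvr : v.2 ≠ r),
      E.hom (cone hua hur) ≫ E.hom (cone' hub hur) =
        E.hom (cone hva hvr) ≫ E.hom (cone' hvb hvr) := by
    intro a b u v hua hub hur hva hvb hvr
    refine induction_along_edges hmn hk (a := a) (b := b) hr
      (P := fun w => ∀ (hwa : w.1 ≠ a) (hwb : w.1 ≠ b) (hwr : w.2 ≠ r),
        E.hom (cone hua hur) ≫ E.hom (cone' hub hur) =
          E.hom (cone hwa hwr) ≫ E.hom (cone' hwb hwr)) ?_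
      ⟨hua, hub, hur⟩ ⟨hva, hvb, hvr⟩ (fun _ _ _ => rfl) hva hvb hvr
    rintro x y ⟨hxa, hxb, hxr⟩ ⟨hya, hyb, hyr⟩ hxy h - - -
    rw [h hxa hxb hxr, ← E.comp hxy (cone' hyb hyr) (cone' hxb hxr),
      ← E.comp (cone hxa hxr) hxy (cone hya hyr) (coneRow a x y hxa hya hxr hyr hxy),
      Category.assoc]
    refine (coneRow b x y hxb hyb hxr hyr hxy).mono ?_
    intro z; simp; tauto
  choose d hda hdb using fun a b : Fin m =>
    (exists_fin_ne₃ (by omega) a b b).imp fun _ h => (⟨h.1, h.2.1⟩ : _ ∧ _)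
  let c : ∀ a b : Fin m, E.obj (a, r) ⟶ E.obj (b, r) := fun a b =>
    E.hom (cone (u := (d a b, s)) (hda a b) hs) ≫ E.hom (cone' (u := (d a b, s)) (hdb a b) hs)
  have hc : ∀ (a b : Fin m) (u : Fin m × Fin n) (hua : u.1 ≠ a) (hub : u.1 ≠ b) (hur : u.2 ≠ r),
      c a b = E.hom (cone hua hur) ≫ E.hom (cone' hub hur) := fun a b u hua hub hur =>
    indep a b (d a b, s) u (hda a b) (hdb a b) hs hua hub hur
  have hom_self : ∀ u : Fin m × Fin n, ∀ h : IsFace m n k (fun _ => 1) {u, u},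
      E.hom h = 𝟙 _ := by
    intro u h
    have := E.comp h h h (by simpa using h)
    rwa [← cancel_epi (E.hom h), Category.comp_id]
  have hom_symm : ∀ {u v : Fin m × Fin n} (h : IsFace m n k (fun _ => 1) {u, v})
      (h' : IsFace m n k (fun _ => 1) {v, u}), E.hom h ≫ E.hom h' = 𝟙 _ := by
    intro u v h h'
    rw [E.comp h h' (by simpa using single u) (h.mono (by intro z; simp; tauto)), hom_self]
  have c_comp : ∀ a b e : Fin m, c a b ≫ c b e = c a e := by
    intro a b e
    obtain ⟨f, hfa, hfb, hfe⟩ := exists_fin_ne₃ (by omega : 4 ≤ m) a b e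
    rw [hc a b (f, s) hfa hfb hs, hc b e (f, s) hfb hfe hs, hc a e (f, s) hfa hfe hs,
      Category.assoc, ← Category.assoc (E.hom (cone' (u := (f, s)) hfb hs)), hom_symm,
      Category.id_comp]
  -- the potential can be computed using any vertex of the row `r`
  have c_hom : ∀ (a b : Fin m) (v : Fin m × Fin n) (h : IsFace m n k (fun _ => 1) {(a, r), v})
      (h' : IsFace m n k (fun _ => 1) {(b, r), v}), c a b ≫ E.hom h' = E.hom h := by
    intro a b v h h'
    by_cases hvr : v.2 = r
    · obtain ⟨e, hea, heb, hev⟩ := exists_fin_ne₃ (by omega : 4 ≤ m) a b v.1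
      have tri : ∀ x : Fin m, e ≠ x → IsFace m n k (fun _ => 1) {(x, r), v} →
          IsFace m n k (fun _ => 1) {(e, s), (x, r), v} := fun x hx hxv =>
        hxv.insert (by simp [hx.symm, hev.symm]) (by simp [hs.symm, hvr]) (hk _) le_rfl
      have hev' : IsFace m n k (fun _ => 1) {(e, s), v} :=
        (tri b heb h').mono (by intro z; simp; tauto)
      rw [hc a b (e, s) hea heb hs, Category.assoc, E.comp (cone' heb hs) h' hev' (tri b heb h'),
        E.comp (cone hea hs) hev' h]
      exact (tri a hea h).mono (by intro z; simp; tauto)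
    · have hva : v.1 ≠ a := h.fst_ne (u := v) (v := (a, r)) (by simp) (by simp)
        (fun hv => hvr (by rw [hv]))
      have hvb : v.1 ≠ b := h'.fst_ne (u := v) (v := (b, r)) (by simp) (by simp)
        (fun hv => hvr (by rw [hv]))
      rw [hc a b v hva hvb hvr, Category.assoc, hom_symm, Category.comp_id]
  have exists_cone : ∀ u v : Fin m × Fin n, IsFace m n k (fun _ => 1) {u, v} →
      ∃ a, IsFace m n k (fun _ => 1) {(a, r), u, v} := by
    intro u v h
    by_cases hu : u.2 = r
    · exact ⟨u.1, h.mono (by intro z; simp [← hu])⟩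
    by_cases hv : v.2 = r
    · exact ⟨v.1, h.mono (by intro z; simp [← hv])⟩
    obtain ⟨a, hau, hav, -⟩ := exists_fin_ne₃ (by omega : 4 ≤ m) u.1 v.1 v.1
    exact ⟨a, coneRow a u v hau.symm hav.symm hu hv h⟩
  choose q hq using fun v => (exists_cone v v (by simpa using single v))
  let o : Fin m := ⟨0, by omega⟩
  refine ⟨E.obj (o, r), fun v => c o (q v) ≫ E.hom (by simpa using hq v), fun u v h => ?_⟩
  obtain ⟨a, ha⟩ := exists_cone u v h
  have hau : IsFace m n k (fun _ => 1) {(a, r), u} := ha.mono (by intro z; simp; tauto)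
  have hav : IsFace m n k (fun _ => 1) {(a, r), v} := ha.mono (by intro z; simp; tauto)
  dsimp only
  rw [← c_hom (q u) a u _ hau, ← c_hom (q v) a v _ hav, ← Category.assoc (c o _), c_comp,
    ← Category.assoc (c o _), c_comp, Category.assoc, E.comp hau h hav ha]

theorem trivializable_chessboard (hn : 1 ≤ n) (hk : ∀ i, 1 ≤ k i) (hmn : n + 2 ≤ m)
    (hsum : 3 ≤ ∑ i, k i) (E : FlatSystem (IsFace m n k fun _ => 1) C) : E.Trivializable := by
  obtain rfl | rfl | hn3 : n = 1 ∨ n = 2 ∨ 3 ≤ n := by omega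
  · exact trivializable_of_one_row (i := 0) (fun _ => Subsingleton.elim _ _) (by omega)
      (by simpa using hsum) E
  · rw [Fin.sum_univ_two] at hsum
    rcases le_or_gt 2 (k 0) with h | h
    · exact trivializable_of_row le_rfl hmn hk (r := 1)
        (fun i hi => Or.inl (by rwa [show i = 0 by omega])) E
    · exact trivializable_of_row le_rfl hmn hk (r := 0)
        (fun i hi => Or.inl (by rw [show i = 1 by omega]; omega)) E
  · refine trivializable_of_row (by omega) hmn hk (r := ⟨0, hn⟩) (fun i hi => Or.inr ?_) E
    obtain ⟨j, hj⟩ := Fin.exists_notMem_of_card_lt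
      (s := {i, ⟨0, hn⟩}) (Finset.card_le_two.trans_lt hn3)
    exact ⟨j, by simpa using hj⟩

end Trivialization

section Nerve

/-- A nerve criterion for simple connectivity: for an open cover by simply connected sets with path
connected pairwise intersections it suffices to trivialize the flat systems over its nerve. -/
theorem simplyConnectedSpace_of_trivializable {X V : Type*} [TopologicalSpace X] [DecidableEq V]
    [Nonempty V] {K : Finset V → Prop} {U : V → Set X} (hU : ∀ v, IsOpen (U v))
    (hcover : ∀ x, ∃ v, x ∈ U v) (hvert : ∀ v, K {v})
    (hedge : ∀ {u v x}, x ∈ U u → x ∈ U v → K {u, v})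
    (hpair : ∀ {u v}, K {u, v} → IsPathConnected (U u ∩ U v))
    (htriple : ∀ {u v w}, K {u, v, w} → ∃ x, x ∈ U u ∧ x ∈ U v ∧ x ∈ U w)
    (hhom : ∀ v {x y : X} (γ γ' : Path x y), (∀ t, γ t ∈ U v) → (∀ t, γ' t ∈ U v) →
      γ.Homotopic γ')
    (htriv : ∀ E : FlatSystem K (FundamentalGroupoid X), E.Trivializable) :
    SimplyConnectedSpace X := by
  have hjoin : ∀ v {x y}, x ∈ U v → y ∈ U v → JoinedIn (U v) x y := fun v x y hx hy => by
    have := hpair (u := v) (v := v) (by simpa using hvert v)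
    rw [Set.inter_self] at this
    exact this.joinedIn x hx y hy
  let q : ∀ v {x y : X}, x ∈ U v → y ∈ U v →
      (FundamentalGroupoid.mk x ⟶ FundamentalGroupoid.mk y) :=
    fun v x y hx hy =>
      FundamentalGroupoid.fromPath (Path.Homotopic.Quotient.mk (hjoin v hx hy).somePath)
  have hq : ∀ v {x y : X} (hx : x ∈ U v) (hy : y ∈ U v) (γ : Path x y), (∀ t, γ t ∈ U v) →
      FundamentalGroupoid.fromPath (Path.Homotopic.Quotient.mk γ) = q v hx hy :=
    fun v x y hx hy γ hγ =>
      Path.Homotopic.Quotient.eq.2 (hhom v _ _ hγ (hjoin v hx hy).somePath_mem)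
  have q_comp : ∀ v {x y z : X} (hx : x ∈ U v) (hy : y ∈ U v) (hz : z ∈ U v),
      q v hx hy ≫ q v hy hz = q v hx hz := by
    intro v x y z hx hy hz
    rw [← hq v hx hz ((hjoin v hx hy).somePath.trans (hjoin v hy hz).somePath)]
    · rfl
    · intro t
      have := Set.mem_range_self (f := (hjoin v hx hy).somePath.trans (hjoin v hy hz).somePath) t
      rw [Path.trans_range] at this
      rcases this with ⟨s, hs⟩ | ⟨s, hs⟩ <;> rw [← hs] <;> exact JoinedIn.somePath_mem _ _
  have q_self : ∀ v {x : X} (hx : x ∈ U v), q v hx hx = 𝟙 _ := fun v x hx =>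
    (hq v hx hx (Path.refl x) fun _ => hx).symm
  have q_eq : ∀ u v {x y : X} (hxu : x ∈ U u) (hyu : y ∈ U u) (hxv : x ∈ U v) (hyv : y ∈ U v),
      q u hxu hyu = q v hxv hyv := by
    intro u v x y hxu hyu hxv hyv
    have h := (hpair (hedge hxu hxv)).joinedIn x ⟨hxu, hxv⟩ y ⟨hyu, hyv⟩
    rw [← hq u hxu hyu h.somePath fun t => (h.somePath_mem t).1,
      ← hq v hxv hyv h.somePath fun t => (h.somePath_mem t).2]
  choose b hb using fun v => htriple (u := v) (v := v) (w := v) (by simpa using hvert v)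
  replace hb : ∀ v, b v ∈ U v := fun v => (hb v).1
  have q_indep : ∀ u v {x y : X} (hxu : x ∈ U u) (hyu : y ∈ U u) (hxv : x ∈ U v) (hyv : y ∈ U v),
      q u (hb u) hxu ≫ q v hxv (hb v) = q u (hb u) hyu ≫ q v hyv (hb v) := by
    intro u v x y hxu hyu hxv hyv
    rw [← q_comp u (hb u) hyu hxu, q_eq u v hyu hxu hyv hxv, Category.assoc,
      q_comp v hyv hxv (hb v)]
  let E : FlatSystem K (FundamentalGroupoid X) :=
    { obj := fun v => FundamentalGroupoid.mk (b v)
      hom := fun {u v} h =>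
        q u (hb u) (hpair h).nonempty.some_mem.1 ≫ q v (hpair h).nonempty.some_mem.2 (hb v)
      comp := by
        intro u v w huv hvw huw h
        obtain ⟨x, hxu, hxv, hxw⟩ := htriple h
        rw [q_indep u v (hpair huv).nonempty.some_mem.1 hxu (hpair huv).nonempty.some_mem.2 hxv,
          q_indep v w (hpair hvw).nonempty.some_mem.1 hxv (hpair hvw).nonempty.some_mem.2 hxw,
          q_indep u w (hpair huw).nonempty.some_mem.1 hxu (hpair huw).nonempty.some_mem.2 hxw,
          Category.assoc, ← Category.assoc (q v hxv (hb v)), q_comp v hxv (hb v) hxv,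
          q_self v hxv, Category.id_comp] }
  obtain ⟨c, p, hp⟩ := htriv E
  replace hp : ∀ u v {x : X} (hxu : x ∈ U u) (hxv : x ∈ U v),
      p u ≫ q u (hb u) hxu = p v ≫ q v (hb v) hxv := by
    intro u v x hxu hxv
    rw [← hp u v (hedge hxu hxv)]
    have h := (hpair (hedge hxu hxv)).nonempty.some_mem
    change _ = (p u ≫ (q u (hb u) h.1 ≫ q v h.2 (hb v))) ≫ _
    rw [q_indep u v h.1 hxu h.2 hxv, Category.assoc, Category.assoc, q_comp v hxv (hb v) hxv,
      q_self v hxv, Category.comp_id]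
  choose i hi using hcover
  let P : ∀ x : X, c ⟶ FundamentalGroupoid.mk x := fun x => p (i x) ≫ q (i x) (hb _) (hi x)
  have hP : ∀ v {x y : X} (hx : x ∈ U v) (hy : y ∈ U v), P x ≫ q v hx hy = P y := by
    intro v x y hx hy
    change (p (i x) ≫ q (i x) (hb _) (hi x)) ≫ _ = p (i y) ≫ q (i y) (hb _) (hi y)
    rw [hp (i x) v (hi x) hx, hp (i y) v (hi y) hy, Category.assoc, q_comp v (hb v) hx hy]
  have key : ∀ {x y : X} (γ : Path x y),
      P x ≫ FundamentalGroupoid.fromPath (Path.Homotopic.Quotient.mk γ) = P y := by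
    intro x y γ
    let F : ∀ s t, FundamentalGroupoid.mk (γ s) ⟶ FundamentalGroupoid.mk (γ t) := fun s t =>
      FundamentalGroupoid.fromPath (Path.Homotopic.Quotient.mk (γ.subpath s t))
    have F_comp : ∀ r s t, F r s ≫ F s t = F r t := fun r s t =>
      Path.Homotopic.Quotient.eq.2 ⟨Path.Homotopy.subpathTransSubpath γ r s t⟩
    have hlc : IsLocallyConstant fun t => P (γ 0) ≫ F 0 t ≫ Groupoid.inv (P (γ t)) := by
      rw [IsLocallyConstant.iff_eventually_eq]
      intro t
      have hnhds : γ ⁻¹' U (i (γ t)) ∈ nhds t :=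
        γ.continuous.continuousAt.preimage_mem_nhds ((hU _).mem_nhds (hi _))
      obtain ⟨W, hW, hWt, hWU⟩ : ∃ W ∈ nhds t, W.OrdConnected ∧ W ⊆ γ ⁻¹' U (i (γ t)) := by
        obtain ⟨b', c', -, hW, hWU⟩ := exists_Icc_mem_subset_of_mem_nhds hnhds
        exact ⟨Set.Icc b' c', hW, Set.ordConnected_Icc, hWU⟩
      filter_upwards [hW] with s hs
      have hts : F t s = q (i (γ t)) (hi _) (hWU hs) := by
        refine hq _ (hi _) (hWU hs) _ fun r => ?_
        have hr := Set.mem_range_self (f := γ.subpath t s) r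
        rw [Path.range_subpath] at hr
        obtain ⟨z, hz, hzr⟩ := hr
        rw [← hzr]
        exact hWU (hWt.uIcc_subset (mem_of_mem_nhds hW) hs hz)
      rw [← F_comp 0 t s, hts, ← hP (i (γ t)) (hi _) (hWU hs), Groupoid.inv_eq_inv,
        Groupoid.inv_eq_inv, IsIso.inv_comp]
      simp
    have h01 := hlc.apply_eq_of_preconnectedSpace 0 1
    have hF0 : F 0 0 = 𝟙 _ := by
      change FundamentalGroupoid.fromPath (Path.Homotopic.Quotient.mk (γ.subpath 0 0)) = _
      rw [Path.subpath_self]; rfl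
    have hF1 : P (γ 0) ≫ F 0 1 = P (γ 1) := by
      simp only [hF0, Category.id_comp, Groupoid.comp_inv] at h01
      rw [← Category.assoc, Groupoid.inv_eq_inv, eq_comm, IsIso.comp_inv_eq,
        Category.id_comp] at h01
      exact h01
    have cast : ∀ {x' y' : X} (hx : x' = x) (hy : y' = y),
        P x' ≫ FundamentalGroupoid.fromPath (Path.Homotopic.Quotient.mk (γ.cast hx hy)) = P y' →
        P x ≫ FundamentalGroupoid.fromPath (Path.Homotopic.Quotient.mk γ) = P y := by
      rintro _ _ rfl rfl h
      exact h
    refine cast γ.source γ.target ?_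
    rw [← Path.subpath_zero_one]
    exact hF1
  rw [simply_connected_iff_paths_homotopic']
  refine ⟨⟨⟨b (Classical.arbitrary V)⟩, fun x y => ?_⟩, fun {x y} γ γ' => ?_⟩
  · obtain ⟨γ, -⟩ := Path.Homotopic.Quotient.mk_surjective (Groupoid.inv (P x) ≫ P y)
    exact ⟨γ⟩
  · rw [← FundamentalGroupoid.fromPath_eq_iff_homotopic, ← cancel_epi (P x), key, key]

end Nerve

section Geometry

variable {m n : ℕ} {k : Fin n → ℕ} {l : Fin m → ℕ}

/-- The points of the realization all of whose coordinates indexed by `F` are positive. -/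
def openStar (m n : ℕ) (k : Fin n → ℕ) (l : Fin m → ℕ) (F : Finset (Fin m × Fin n)) :
    Set (Fin m × Fin n → ℝ) :=
  {f ∈ Realization m n k l | ∀ v ∈ F, 0 < f v}

/-- The barycenter of a finite set of vertices. -/
noncomputable def barycenter (F : Finset (Fin m × Fin n)) : Fin m × Fin n → ℝ :=
  fun v => if v ∈ F then (F.card : ℝ)⁻¹ else 0

theorem barycenter_nonneg (F : Finset (Fin m × Fin n)) (v) : 0 ≤ barycenter F v := by
  unfold barycenter
  split_ifs <;> positivity

theorem sum_barycenter {F : Finset (Fin m × Fin n)} (hF : F.Nonempty) :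
    ∑ v, barycenter F v = 1 := by
  have := hF.card_pos
  simp only [barycenter, Finset.sum_ite_mem, Finset.univ_inter, Finset.sum_const, nsmul_eq_mul]
  field_simp

theorem barycenter_pos_iff {F : Finset (Fin m × Fin n)} {v} : 0 < barycenter F v ↔ v ∈ F := by
  unfold barycenter
  split_ifs with h
  · have := Finset.card_pos.2 ⟨v, h⟩
    simp only [h, iff_true]
    positivity
  · simp [h]

theorem mem_realization_of_sum {f : Fin m × Fin n → ℝ} (h0 : ∀ v, 0 ≤ f v) (h1 : ∑ v, f v = 1)
    (hf : IsFace m n k l (Finset.univ.filter fun v => 0 < f v)) : f ∈ Realization m n k l :=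
  ⟨fun v => ⟨h0 v, h1 ▸ Finset.single_le_sum (fun w _ => h0 w) (Finset.mem_univ v)⟩, h1, hf⟩

theorem barycenter_mem_openStar {F : Finset (Fin m × Fin n)} (hF : F.Nonempty)
    (h : IsFace m n k l F) : barycenter F ∈ openStar m n k l F :=
  ⟨mem_realization_of_sum (barycenter_nonneg F) (sum_barycenter hF)
    (by simpa [barycenter_pos_iff] using h), fun _ => barycenter_pos_iff.2⟩

theorem starConvex_openStar {F : Finset (Fin m × Fin n)} (hF : F.Nonempty) :
    StarConvex ℝ (barycenter F) (openStar m n k l F) := by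
  intro f hf a b ha hb hab
  obtain ⟨⟨hf01, hfsum, hface⟩, hpos⟩ := hf
  have hval : ∀ v, (a • barycenter F + b • f) v = a * barycenter F v + b * f v := fun _ => rfl
  refine ⟨mem_realization_of_sum (fun v => ?_) ?_ (hface.mono fun v hv => ?_), fun v hv => ?_⟩
  · have := barycenter_nonneg F v
    have := (hf01 v).1
    rw [hval]
    positivity
  · simp only [hval, Finset.sum_add_distrib, ← Finset.mul_sum, sum_barycenter hF, hfsum, mul_one,
      hab]
  · simp only [Finset.mem_filter, Finset.mem_univ, true_and, hval] at hv ⊢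
    by_contra hfv
    have hvF : ¬ 0 < barycenter F v := fun h => hfv (hpos v (barycenter_pos_iff.1 h))
    nlinarith [mul_nonneg ha (sub_nonneg.2 (not_lt.1 hvF)),
      mul_nonneg hb (sub_nonneg.2 (not_lt.1 hfv))]
  · have h1 := barycenter_pos_iff.2 hv
    have h2 := hpos v hv
    rw [hval]
    rcases ha.eq_or_lt with rfl | ha
    · rw [zero_add] at hab
      simpa [hab] using h2
    · positivity

theorem openStar_subset (F : Finset (Fin m × Fin n)) : openStar m n k l F ⊆ Realization m n k l :=
  fun _ h => h.1

theorem homotopic_of_mem_openStar {F : Finset (Fin m × Fin n)} (hF : F.Nonempty)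
    {x y : Realization m n k l} (γ γ' : Path x y) (hγ : ∀ t, (γ t).1 ∈ openStar m n k l F)
    (hγ' : ∀ t, (γ' t).1 ∈ openStar m n k l F) : γ.Homotopic γ' := by
  have hx : x.1 ∈ openStar m n k l F := by simpa using hγ 0
  have hy : y.1 ∈ openStar m n k l F := by simpa using hγ 1
  have := (starConvex_openStar (k := k) (l := l) hF).contractibleSpace ⟨_, hx⟩
  let lift : ∀ δ : Path x y, (∀ t, (δ t).1 ∈ openStar m n k l F) →
      Path (⟨x.1, hx⟩ : openStar m n k l F) ⟨y.1, hy⟩ := fun δ hδ =>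
    { toFun := fun t => ⟨(δ t).1, hδ t⟩
      continuous_toFun := by fun_prop
      source' := by simp
      target' := by simp }
  exact (SimplyConnectedSpace.paths_homotopic (lift γ hγ) (lift γ' hγ')).map
    ⟨Set.inclusion (openStar_subset F), continuous_inclusion _⟩

end Geometry

theorem simply_connected_of_multiple_chessboard_complex
    (m n : ℕ) (hm : 1 ≤ m) (hn : 1 ≤ n) (k : Fin n → ℕ) (hk : ∀ i, 1 ≤ k i)
    (hmn : n + 2 ≤ m) (hsum : 3 ≤ ∑ i, k i) :
    SimplyConnectedSpace ↥(Realization m n k fun _ => 1) := by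
  have : Nonempty (Fin m × Fin n) := ⟨⟨⟨0, hm⟩, ⟨0, hn⟩⟩⟩
  refine simplyConnectedSpace_of_trivializable (K := IsFace m n k fun _ => 1)
    (U := fun v => {f | 0 < f.1 v}) (fun v => ?_) (fun x => ?_) (fun v => ?_)
    (fun {u v x} hu hv => ?_) (fun {u v} h => ?_) (fun {u v w} h => ?_)
    (fun v {x y} γ γ' hγ hγ' => ?_)
    (trivializable_chessboard hn hk hmn hsum)
  · exact isOpen_lt continuous_const ((continuous_apply v).comp continuous_subtype_val)
  · by_contra! h
    have h0 : ∑ v, x.1 v ≤ 0 := Finset.sum_nonpos fun v _ => not_lt.1 (h v)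
    linarith [x.2.2.1]
  · simpa using (isFace_empty (k := k) (l := fun _ => 1)).insert (x := v) (by simp) (by simp) (hk _)
      le_rfl
  · refine x.2.2.2.mono ?_
    rw [Finset.insert_subset_iff, Finset.singleton_subset_iff]
    simpa using ⟨hu, hv⟩
  · have hne : ({u, v} : Finset (Fin m × Fin n)).Nonempty := Finset.insert_nonempty _ _
    have hp := (starConvex_openStar (k := k) (l := fun _ => 1) hne).isPathConnected
      (barycenter_mem_openStar hne h)
    convert hp.preimage_coe (openStar_subset _) using 1
    ext x
    simp [openStar]
  · have hb := barycenter_mem_openStar (Finset.insert_nonempty _ _) h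
    have hx := hb.2
    exact ⟨⟨_, hb.1⟩, hx u (by simp), hx v (by simp), hx w (by simp)⟩
  · exact homotopic_of_mem_openStar (Finset.singleton_nonempty v) γ γ'
      (fun t => ⟨(γ t).2, by simpa using hγ t⟩) fun t => ⟨(γ' t).2, by simpa using hγ' t⟩
end
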